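/- arXiv:1905.09529 — 3 statements merged into one kernel-verified Lean document; each statement's English description precedes it below -/
import Mathlib

section
/- Mixed-norm convolution estimate from kernel decay: Let μ be a tempered Radon measure on ℝ³ whose Fourier transform is a measurable function satisfying |ℱμ(x₁,x₂,x₃)| ≤ A (1+|x₃|)^{−σ̃} for some σ̃ ∈ [0,1). Then the convolution operator T f = f * ℱμ is bounded from L^{2/(2−σ̃)}_{x₃}(L¹_{(x₁,x₂)}) to L^{2/σ̃}_{x₃}(L^∞_{(x₁,x₂)}) with operator norm ≲ A. -/
open MeasureTheory
open scoped ENNReal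

/-- Outer `Lᵖ` norm in the `x₃`-variable of an `ℝ≥0∞`-valued function. -/
noncomputable def outerNorm (p : ℝ≥0∞) (g : ℝ → ℝ≥0∞) : ℝ≥0∞ :=
  if p = ∞ then essSup g volume
  else (∫⁻ x, g x ^ p.toReal) ^ (1 / p.toReal)

/-- Mixed norm `‖f‖_{L^{p₃}_{x₃}(L^{p₁}_{(x₁,x₂)})}` on `ℝ³`. -/
noncomputable def mixedNorm (p₁ p₃ : ℝ≥0∞) (f : ℝ × ℝ × ℝ → ℂ) : ℝ≥0∞ :=
  outerNorm p₃ fun x₃ => eLpNorm (fun y : ℝ × ℝ => f (y.1, y.2, x₃)) p₁ volume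

namespace HLS

/-- power integral -/
lemma lint_pow (s r : ℝ) (hs : -1 < s) (hr : 0 ≤ r) :
    ∫⁻ t in Set.Ioc 0 r, ENNReal.ofReal (t ^ s) = ENNReal.ofReal (r ^ (s+1) / (s+1)) := by
  have h1 : IntegrableOn (fun t : ℝ => t ^ s) (Set.Ioc 0 r) := by
    have := intervalIntegral.intervalIntegrable_rpow' (a := 0) (b := r) hs
    exact (intervalIntegrable_iff_integrableOn_Ioc_of_le hr).1 this
  rw [← ofReal_integral_eq_lintegral_ofReal h1, ← intervalIntegral.integral_of_le hr,
    integral_rpow (Or.inl hs), Real.zero_rpow (by linarith), sub_zero]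
  filter_upwards [ae_restrict_mem measurableSet_Ioc] with t ht
  exact Real.rpow_nonneg ht.1.le _

/-- the kernel -/
noncomputable def ker (σ t : ℝ) : ℝ≥0∞ := ENNReal.ofReal ((1 + |t|) ^ (-σ))

lemma ker_neg (σ t : ℝ) : ker σ (-t) = ker σ t := by simp [ker]

lemma measurable_ker (σ : ℝ) : Measurable (ker σ) := by
  unfold ker; fun_prop

lemma measurable_ker_sub (σ : ℝ) : Measurable (fun z : ℝ × ℝ => ker σ (z.1 - z.2)) :=
  (measurable_ker σ).comp (measurable_fst.sub measurable_snd)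

lemma ker_le (σ r t : ℝ) (hσ0 : 0 ≤ σ) (hr : 0 < r) (ht : t ≠ 0) :
    ker σ t ≤ (Set.Ioc 0 r).indicator (fun t => ENNReal.ofReal (t ^ (-σ))) t
      + (Set.Ioc 0 r).indicator (fun t => ENNReal.ofReal (t ^ (-σ))) (-t)
      + ENNReal.ofReal (r ^ (-σ)) := by
  have hpos : 0 < |t| := abs_pos.2 ht
  have h0 : ker σ t ≤ ENNReal.ofReal (|t| ^ (-σ)) := by
    apply ENNReal.ofReal_le_ofReal
    exact Real.rpow_le_rpow_of_nonpos hpos (by linarith) (by linarith)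
  rcases le_or_gt |t| r with h | h
  · rcases lt_or_gt_of_ne ht with h' | h'
    · rw [abs_of_neg h'] at h0 h
      rw [Set.indicator_of_mem (s := Set.Ioc 0 r) (a := -t) ⟨by linarith, h⟩]
      exact h0.trans (le_add_right le_add_self)
    · rw [abs_of_pos h'] at h0 h
      rw [Set.indicator_of_mem (s := Set.Ioc 0 r) (a := t) ⟨h', h⟩]
      exact h0.trans (le_add_right le_self_add)
  · refine h0.trans (le_trans ?_ le_add_self)
    apply ENNReal.ofReal_le_ofReal
    exact Real.rpow_le_rpow_of_nonpos hr h.le (by linarith)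

lemma set_bound (σ : ℝ) (hσ0 : 0 ≤ σ) (hσ1 : σ < 1) (E : Set ℝ) (y : ℝ) :
    ∫⁻ x in E, ker σ (x - y) ≤ ENNReal.ofReal (2 / (1 - σ) + 1) * volume E ^ (1 - σ) := by
  have hs : 0 < 1 - σ := by linarith
  rcases eq_or_ne (volume E) 0 with h0 | h0
  · simp [Measure.restrict_eq_zero.2 h0]
  rcases eq_or_ne (volume E) ∞ with h1 | h1
  · rw [h1, ENNReal.top_rpow_of_pos hs, ENNReal.mul_top]
    · exact le_top
    · have : 0 < 2 / (1 - σ) + 1 := by positivity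
      simpa using this
  set r := (volume E).toReal with hr
  have hrpos : 0 < r := ENNReal.toReal_pos h0 h1
  have hE : volume E = ENNReal.ofReal r := (ENNReal.ofReal_toReal h1).symm
  set φ : ℝ → ℝ≥0∞ := (Set.Ioc 0 r).indicator (fun t => ENNReal.ofReal (t ^ (-σ))) with hφ
  have hφm : Measurable φ := by
    apply Measurable.indicator _ measurableSet_Ioc
    fun_prop
  have hφi : ∫⁻ t, φ t = ENNReal.ofReal (r ^ (1 - σ) / (1 - σ)) := by
    rw [hφ, lintegral_indicator measurableSet_Ioc, lint_pow _ _ (by linarith) hrpos.le]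
    congr 2 <;> ring_nf
  have hae : ∀ᵐ x : ℝ, x ≠ y := by
    simp [ae_iff]
  calc ∫⁻ x in E, ker σ (x - y)
      ≤ ∫⁻ x in E, (φ (x - y) + φ (-(x - y)) + ENNReal.ofReal (r ^ (-σ))) := by
        apply lintegral_mono_ae
        filter_upwards [ae_restrict_of_ae hae] with x hx
        exact ker_le σ r _ hσ0 hrpos (sub_ne_zero.2 hx)
    _ = (∫⁻ x in E, φ (x - y)) + (∫⁻ x in E, φ (y - x)) + ENNReal.ofReal (r ^ (-σ)) * volume E := by
        rw [lintegral_add_right _ measurable_const, lintegral_add_right _ (by fun_prop)]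
        simp
    _ ≤ (∫⁻ x, φ (x - y)) + (∫⁻ x, φ (y - x)) + ENNReal.ofReal (r ^ (-σ)) * volume E := by
        gcongr <;> exact Measure.restrict_le_self
    _ = ENNReal.ofReal (2 / (1 - σ) + 1) * volume E ^ (1 - σ) := by
        rw [lintegral_sub_right_eq_self (fun x => φ x) y, lintegral_sub_left_eq_self (fun x => φ x) y, hφi, hE,
          ENNReal.ofReal_rpow_of_pos hrpos, ← ENNReal.ofReal_mul (by positivity),
          ← ENNReal.ofReal_mul (by positivity), ← ENNReal.ofReal_add (by positivity) (by positivity),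
          ← ENNReal.ofReal_add (by positivity) (by positivity)]
        congr 1
        have : r ^ (-σ) * r = r ^ (1 - σ) := by
          rw [← Real.rpow_add_one hrpos.ne']; ring_nf
        rw [this]; ring

/-- layer cake with weight -/
lemma layer (f u : ℝ → ℝ≥0∞) (hf : Measurable f) (hu : Measurable u) :
    ∫⁻ x, f x * u x = ∫⁻ a in Set.Ioi (0:ℝ), ∫⁻ x in {x | ENNReal.ofReal a < f x}, u x := by
  have hS : MeasurableSet {z : ℝ × ℝ | ENNReal.ofReal z.1 < f z.2} :=
    measurableSet_lt (by fun_prop) (by fun_prop)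
  have h1 : ∀ x, f x = ∫⁻ a in Set.Ioi (0:ℝ),
      {z : ℝ × ℝ | ENNReal.ofReal z.1 < f z.2}.indicator (fun _ => 1) (a, x) := by
    intro x
    have : ∀ a : ℝ, {z : ℝ × ℝ | ENNReal.ofReal z.1 < f z.2}.indicator (fun _ => (1:ℝ≥0∞)) (a, x)
      = {a : ℝ | ENNReal.ofReal a < f x}.indicator (fun _ => 1) a := by
        intro a; simp [Set.indicator]
    simp_rw [this]
    have hm : MeasurableSet {a : ℝ | ENNReal.ofReal a < f x} :=
      measurableSet_lt (by fun_prop) (by fun_prop)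
    rw [lintegral_indicator hm, Measure.restrict_restrict hm]
    simp only [lintegral_const, one_mul, Measure.restrict_apply_univ]
    rcases eq_or_ne (f x) ∞ with h | h
    · simp [h]
    · have : {a : ℝ | ENNReal.ofReal a < f x} ∩ Set.Ioi 0 = Set.Ioo 0 (f x).toReal := by
        ext a
        simp only [Set.mem_inter_iff, Set.mem_ofPred_eq, Set.mem_Ioi, Set.mem_Ioo]
        constructor
        · rintro ⟨h1, h2⟩
          exact ⟨h2, (ENNReal.ofReal_lt_iff_lt_toReal h2.le h).1 h1⟩
        · rintro ⟨h2, h1⟩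
          exact ⟨(ENNReal.ofReal_lt_iff_lt_toReal h2.le h).2 h1, h2⟩
      rw [this, Real.volume_Ioo, sub_zero, ENNReal.ofReal_toReal h]
  have hm1 : Measurable ({z : ℝ × ℝ | ENNReal.ofReal z.1 < f z.2}.indicator (fun _ => (1:ℝ≥0∞))) :=
    measurable_const.indicator hS
  calc ∫⁻ x, f x * u x = ∫⁻ x, ∫⁻ a in Set.Ioi (0:ℝ),
      {z : ℝ × ℝ | ENNReal.ofReal z.1 < f z.2}.indicator (fun _ => 1) (a, x) * u x := by
        apply lintegral_congr
        intro x
        rw [lintegral_mul_const _ (by fun_prop), ← h1]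
    _ = ∫⁻ a in Set.Ioi (0:ℝ), ∫⁻ x,
      {z : ℝ × ℝ | ENNReal.ofReal z.1 < f z.2}.indicator (fun _ => 1) (a, x) * u x := by
        apply lintegral_lintegral_swap
        apply Measurable.aemeasurable
        have : Measurable fun z : ℝ × ℝ => {z : ℝ × ℝ | ENNReal.ofReal z.1 < f z.2}.indicator (fun _ => (1:ℝ≥0∞)) (z.2, z.1) := hm1.comp measurable_swap
        exact this.mul (hu.comp measurable_fst)
    _ = _ := by
        apply lintegral_congr
        intro a
        rw [← lintegral_indicator (measurableSet_lt (by fun_prop) (by fun_prop))]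
        apply lintegral_congr
        intro x
        simp [Set.indicator]

/-- distribution function -/
noncomputable def dist (f : ℝ → ℝ≥0∞) (a : ℝ) : ℝ≥0∞ := volume {x | ENNReal.ofReal a < f x}

lemma measurable_dist (f : ℝ → ℝ≥0∞) : Measurable (dist f) := by
  apply Antitone.measurable
  intro a b hab
  apply measure_mono
  intro x hx
  exact lt_of_le_of_lt (ENNReal.ofReal_le_ofReal hab) hx

lemma dist_moment (f : ℝ → ℝ≥0∞) (hf : Measurable f) (p : ℝ) (hp : 1 ≤ p) :
    ∫⁻ a in Set.Ioi (0:ℝ), dist f a * ENNReal.ofReal (a ^ (p - 1)) ≤ ∫⁻ x, f x ^ p := by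
  have hm : Measurable fun z : ℝ × ℝ => {z : ℝ × ℝ | ENNReal.ofReal z.1 < f z.2}.indicator
      (fun z => ENNReal.ofReal (z.1 ^ (p - 1))) z :=
    Measurable.indicator (by fun_prop) (measurableSet_lt (by fun_prop) (by fun_prop))
  calc ∫⁻ a in Set.Ioi (0:ℝ), dist f a * ENNReal.ofReal (a ^ (p - 1))
      = ∫⁻ a in Set.Ioi (0:ℝ), ∫⁻ x, {z : ℝ × ℝ | ENNReal.ofReal z.1 < f z.2}.indicator
          (fun z => ENNReal.ofReal (z.1 ^ (p - 1))) (a, x) := by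
        apply lintegral_congr
        intro a
        have hm' : MeasurableSet {x | ENNReal.ofReal a < f x} :=
          measurableSet_lt (by fun_prop) (by fun_prop)
        rw [dist, mul_comm, ← lintegral_indicator_const hm']
        apply lintegral_congr
        intro x
        simp [Set.indicator]
    _ = ∫⁻ x, ∫⁻ a in Set.Ioi (0:ℝ), {z : ℝ × ℝ | ENNReal.ofReal z.1 < f z.2}.indicator
          (fun z => ENNReal.ofReal (z.1 ^ (p - 1))) (a, x) :=
        lintegral_lintegral_swap hm.aemeasurable
    _ ≤ _ := by
        apply lintegral_mono
        intro x
        rcases eq_or_ne (f x) ∞ with h | h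
        · simp [h, ENNReal.top_rpow_of_pos (by linarith : 0 < p)]
        calc ∫⁻ a in Set.Ioi (0:ℝ), {z : ℝ × ℝ | ENNReal.ofReal z.1 < f z.2}.indicator
              (fun z => ENNReal.ofReal (z.1 ^ (p - 1))) (a, x)
            ≤ ∫⁻ a, (Set.Ioc 0 (f x).toReal).indicator (fun a => ENNReal.ofReal (a ^ (p-1))) a := by
              rw [← lintegral_indicator measurableSet_Ioi]
              apply lintegral_mono
              intro a
              by_cases h1 : 0 < a
              · by_cases h2 : ENNReal.ofReal a < f x
                · have := (ENNReal.ofReal_lt_iff_lt_toReal h1.le h).1 h2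
                  simp [Set.indicator, h1, h2, this.le]
                · simp [Set.indicator, h2]
              · simp [Set.indicator, h1]
          _ = ENNReal.ofReal ((f x).toReal ^ p / p) := by
              rw [lintegral_indicator measurableSet_Ioc, lint_pow _ _ (by linarith) (by simp)]
              simp
          _ ≤ ENNReal.ofReal ((f x).toReal ^ p) := by
              apply ENNReal.ofReal_le_ofReal
              apply div_le_self _ hp
              positivity
          _ = f x ^ p := by
              rw [← ENNReal.ofReal_rpow_of_nonneg (by simp) (by linarith), ENNReal.ofReal_toReal h]

lemma dist_cheb (f : ℝ → ℝ≥0∞) (hf : Measurable f) (p : ℝ) (hp : 1 ≤ p)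
    (hF : ∫⁻ x, f x ^ p ≤ 1) (a : ℝ) (ha : 0 < a) : dist f a ≤ ENNReal.ofReal (a ^ (-p)) := by
  have hpa : 0 < a ^ p := Real.rpow_pos_of_pos ha p
  have h1 := mul_meas_ge_le_lintegral (μ := volume) (hf.pow_const p) (ENNReal.ofReal (a ^ p))
  have h2 : dist f a ≤ volume {x | ENNReal.ofReal (a ^ p) ≤ f x ^ p} := by
    apply measure_mono
    intro x hx
    simp only [Set.mem_ofPred_eq] at hx ⊢
    rw [← ENNReal.ofReal_rpow_of_pos ha]
    exact ENNReal.rpow_le_rpow hx.le (by linarith)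
  have h3 : ENNReal.ofReal (a ^ p) * dist f a ≤ 1 := (mul_le_mul_right h2 _).trans (h1.trans hF)
  rw [Real.rpow_neg ha.le, ENNReal.ofReal_inv_of_pos hpa]
  rw [ENNReal.le_inv_iff_mul_le, mul_comm]
  exact h3

lemma dist_int (f : ℝ → ℝ≥0∞) (hf : Measurable f) (σ p : ℝ) (hσ0 : 0 < σ) (hσ1 : σ < 1)
    (hp : p = 2 / (2 - σ))
    (hF : ∫⁻ x, f x ^ p ≤ 1) (a : ℝ) (ha : 0 < a) :
    ∫⁻ b in Set.Ioc 0 a, dist f b ^ (1 - σ) ≤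
      ENNReal.ofReal (1 / (p - 1)) * ENNReal.ofReal (a ^ (p - 1)) := by
  have h2 : 0 < 2 - σ := by linarith
  have hp1 : p - 1 = σ / (2 - σ) := by rw [hp]; field_simp; ring
  have hpp : 0 < p - 1 := by rw [hp1]; positivity
  have he : -(p * (1 - σ)) + 1 = p - 1 := by rw [hp]; field_simp; ring
  calc _ ≤ ∫⁻ b in Set.Ioc 0 a, ENNReal.ofReal (b ^ (-(p * (1 - σ)))) := by
        apply setLIntegral_mono' measurableSet_Ioc
        intro b hb
        have hpb : 0 < b ^ (-p) := Real.rpow_pos_of_pos hb.1 _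
        refine (ENNReal.rpow_le_rpow (dist_cheb f hf p (by linarith) hF b hb.1) (by linarith)).trans ?_
        rw [ENNReal.ofReal_rpow_of_pos hpb, ← Real.rpow_mul hb.1.le, neg_mul]
    _ = _ := by
        rw [lint_pow _ _ (by linarith) ha.le, he, ← ENNReal.ofReal_mul (by positivity)]
        congr 1; ring

end HLS

namespace HLS

/-- the convolution operator -/
noncomputable def op (σ : ℝ) (f : ℝ → ℝ≥0∞) (y : ℝ) : ℝ≥0∞ := ∫⁻ x, f x * ker σ (x - y)

lemma measurable_op (σ : ℝ) (f : ℝ → ℝ≥0∞) (hf : Measurable f) : Measurable (op σ f) := by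
  unfold op
  apply Measurable.lintegral_prod_left' (f := fun z : ℝ × ℝ => f z.1 * ker σ (z.1 - z.2))
  exact (hf.comp measurable_fst).mul (measurable_ker_sub σ)

lemma set_set (σ : ℝ) (hσ0 : 0 ≤ σ) (hσ1 : σ < 1) (E S : Set ℝ) :
    ∫⁻ x in E, ∫⁻ y in S, ker σ (x - y) ≤
      ENNReal.ofReal (2 / (1 - σ) + 1) * (volume E * volume S ^ (1 - σ)) := by
  calc _ ≤ ∫⁻ x in E, ENNReal.ofReal (2 / (1 - σ) + 1) * volume S ^ (1 - σ) := by
        apply lintegral_mono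
        intro x
        refine le_trans (le_of_eq ?_) (set_bound σ hσ0 hσ1 S x)
        apply lintegral_congr
        intro y
        rw [← ker_neg]; congr 1; ring
    _ = _ := by simp; ring

lemma set_set' (σ : ℝ) (hσ0 : 0 ≤ σ) (hσ1 : σ < 1) (E S : Set ℝ) :
    ∫⁻ x in E, ∫⁻ y in S, ker σ (x - y) ≤
      ENNReal.ofReal (2 / (1 - σ) + 1) * (volume S * volume E ^ (1 - σ)) := by
  rw [lintegral_lintegral_swap (measurable_ker_sub σ).aemeasurable]
  refine le_trans (le_of_eq ?_) (set_set σ hσ0 hσ1 S E)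
  apply lintegral_congr
  intro y
  apply lintegral_congr
  intro x
  rw [← ker_neg]; congr 1; ring

/-- half of the double integral -/
lemma half (σ p : ℝ) (hσ0 : 0 < σ) (hσ1 : σ < 1) (hp : p = 2 / (2 - σ))
    (f h : ℝ → ℝ≥0∞) (hf : Measurable f) (hh : Measurable h)
    (hF : ∫⁻ x, f x ^ p ≤ 1) (hH : ∫⁻ x, h x ^ p ≤ 1) :
    ∫⁻ a in Set.Ioi (0:ℝ), ∫⁻ b in Set.Ioi (0:ℝ),
      (if b ≤ a then dist f a * dist h b ^ (1 - σ) else 0) ≤ ENNReal.ofReal (1 / (p - 1)) := by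
  have h2 : 0 < 2 - σ := by linarith
  have hp1 : p - 1 = σ / (2 - σ) := by rw [hp]; field_simp; ring
  have hpp : 0 < p - 1 := by rw [hp1]; positivity
  calc _ ≤ ∫⁻ a in Set.Ioi (0:ℝ), ENNReal.ofReal (1 / (p - 1)) *
          (dist f a * ENNReal.ofReal (a ^ (p - 1))) := by
        apply setLIntegral_mono' measurableSet_Ioi
        intro a ha
        calc _ = ∫⁻ b in Set.Ioc 0 a, dist f a * dist h b ^ (1 - σ) := by
              rw [← lintegral_indicator measurableSet_Ioi, ← lintegral_indicator measurableSet_Ioc]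
              apply lintegral_congr
              intro b
              by_cases h1 : 0 < b <;> by_cases h2 : b ≤ a <;> simp [Set.indicator, h1, h2]
          _ = dist f a * ∫⁻ b in Set.Ioc 0 a, dist h b ^ (1 - σ) :=
              lintegral_const_mul _ ((measurable_dist h).pow_const _)
          _ ≤ dist f a * (ENNReal.ofReal (1 / (p - 1)) * ENNReal.ofReal (a ^ (p - 1))) := by
              gcongr
              exact dist_int h hh σ p hσ0 hσ1 hp hH a ha
          _ = _ := by ring
    _ = ENNReal.ofReal (1 / (p - 1)) *
          ∫⁻ a in Set.Ioi (0:ℝ), (dist f a * ENNReal.ofReal (a ^ (p - 1))) := by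
        apply lintegral_const_mul
        exact (measurable_dist f).mul (by fun_prop)
    _ ≤ ENNReal.ofReal (1 / (p - 1)) * 1 := by
        gcongr
        exact (dist_moment f hf p (by linarith)).trans hF
    _ = _ := mul_one _

lemma bilin (σ p : ℝ) (hσ0 : 0 < σ) (hσ1 : σ < 1) (hp : p = 2 / (2 - σ))
    (f h : ℝ → ℝ≥0∞) (hf : Measurable f) (hh : Measurable h)
    (hF : ∫⁻ x, f x ^ p ≤ 1) (hH : ∫⁻ x, h x ^ p ≤ 1) :
    ∫⁻ y, h y * op σ f y ≤ ENNReal.ofReal (2 / (1 - σ) + 1) *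
      (ENNReal.ofReal (1 / (p - 1)) + ENNReal.ofReal (1 / (p - 1))) := by
  set C := ENNReal.ofReal (2 / (1 - σ) + 1)
  have hG : ∀ b : ℝ, ∫⁻ y in {y | ENNReal.ofReal b < h y}, op σ f y =
      ∫⁻ a in Set.Ioi (0:ℝ), ∫⁻ x in {x | ENNReal.ofReal a < f x},
        ∫⁻ y in {y | ENNReal.ofReal b < h y}, ker σ (x - y) := by
    intro b
    rw [← layer f _ hf (Measurable.lintegral_prod_right (measurable_ker_sub σ))]
    unfold op
    rw [lintegral_lintegral_swap]
    · apply lintegral_congr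
      intro x
      rw [lintegral_const_mul]
      exact (measurable_ker σ).comp (measurable_const.sub measurable_id)
    · apply Measurable.aemeasurable
      exact (hf.comp measurable_snd).mul ((measurable_ker σ).comp (measurable_snd.sub measurable_fst))
  have hm : ∀ (f h : ℝ → ℝ≥0∞), Measurable fun z : ℝ × ℝ =>
      (if z.2 ≤ z.1 then dist f z.1 * dist h z.2 ^ (1 - σ) else 0) := by
    intro f h
    apply Measurable.ite (measurableSet_le measurable_snd measurable_fst) _ measurable_const
    exact ((measurable_dist f).comp measurable_fst).mul
      (((measurable_dist h).comp measurable_snd).pow_const _)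
  have hm1 : Measurable fun z : ℝ × ℝ =>
      (if z.1 ≤ z.2 then dist f z.2 * dist h z.1 ^ (1 - σ) else 0) := (hm f h).comp measurable_swap
  rw [layer h _ hh (measurable_op σ f hf)]
  simp_rw [hG]
  calc _ ≤ ∫⁻ b in Set.Ioi (0:ℝ), ∫⁻ a in Set.Ioi (0:ℝ), C *
          ((if b ≤ a then dist f a * dist h b ^ (1 - σ) else 0) +
           (if a ≤ b then dist h b * dist f a ^ (1 - σ) else 0)) := by
        apply lintegral_mono; intro b
        apply lintegral_mono; intro a
        rcases le_total b a with hab | hab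
        · refine (set_set σ hσ0.le hσ1 _ _).trans ?_
          apply mul_le_mul_right
          rw [if_pos hab]
          exact le_self_add
        · refine (set_set' σ hσ0.le hσ1 _ _).trans ?_
          apply mul_le_mul_right
          rw [if_pos hab]
          exact le_add_self
    _ = C * ((∫⁻ b in Set.Ioi (0:ℝ), ∫⁻ a in Set.Ioi (0:ℝ),
          (if b ≤ a then dist f a * dist h b ^ (1 - σ) else 0)) +
          ∫⁻ b in Set.Ioi (0:ℝ), ∫⁻ a in Set.Ioi (0:ℝ),
           (if a ≤ b then dist h b * dist f a ^ (1 - σ) else 0)) := by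
        rw [← lintegral_add_left (Measurable.lintegral_prod_right hm1), ← lintegral_const_mul]
        · apply lintegral_congr; intro b
          have e1 : Measurable fun a : ℝ => if b ≤ a then dist f a * dist h b ^ (1 - σ) else 0 :=
            hm1.comp (measurable_prodMk_left (x := b))
          have e2 : Measurable fun a : ℝ => if a ≤ b then dist h b * dist f a ^ (1 - σ) else 0 :=
            (hm h f).comp (measurable_prodMk_left (x := b))
          rw [← lintegral_add_left e1, ← lintegral_const_mul]
          exact e1.add e2
        · exact (Measurable.lintegral_prod_right hm1).add (Measurable.lintegral_prod_right (hm h f))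
    _ ≤ _ := by
        gcongr
        · rw [lintegral_lintegral_swap hm1.aemeasurable]
          exact half σ p hσ0 hσ1 hp f h hf hh hF hH
        · exact half σ p hσ0 hσ1 hp h f hh hf hH hF

lemma bilin_scaled (σ p : ℝ) (hσ0 : 0 < σ) (hσ1 : σ < 1) (hp : p = 2 / (2 - σ))
    (f h : ℝ → ℝ≥0∞) (hf : Measurable f) (hh : Measurable h)
    (hF : ∫⁻ x, f x ^ p ≤ 1) (N : ℝ≥0∞) (hN0 : N ≠ 0) (hN1 : N ≠ ∞) (hH : ∫⁻ x, h x ^ p ≤ N) :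
    ∫⁻ y, h y * op σ f y ≤ ENNReal.ofReal (2 / (1 - σ) + 1) *
      (ENNReal.ofReal (1 / (p - 1)) + ENNReal.ofReal (1 / (p - 1))) * N ^ (1 / p) := by
  have h2 : 0 < 2 - σ := by linarith
  have hp0 : 0 < p := by rw [hp]; positivity
  have hc0 : N ^ (1 / p) ≠ 0 := by simp [hN0, hN1]
  have hc1 : N ^ (1 / p) ≠ ∞ := ENNReal.rpow_ne_top_of_nonneg (by positivity) hN1
  have hcp : (N ^ (1 / p)) ^ p = N := by
    rw [← ENNReal.rpow_mul, one_div_mul_cancel hp0.ne', ENNReal.rpow_one]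
  set c := N ^ (1 / p)
  have key := bilin σ p hσ0 hσ1 hp f (fun x => c⁻¹ * h x) hf (hh.const_mul _) hF (by
    simp_rw [ENNReal.mul_rpow_of_nonneg _ _ hp0.le]
    rw [lintegral_const_mul _ (hh.pow_const _), ENNReal.inv_rpow, hcp]
    calc N⁻¹ * _ ≤ N⁻¹ * N := by gcongr
      _ = 1 := ENNReal.inv_mul_cancel hN0 hN1)
  simp_rw [mul_assoc] at key
  have hmm : Measurable fun y => h y * op σ f y := hh.mul (measurable_op σ f hf)
  rw [lintegral_const_mul _ hmm, ENNReal.inv_mul_le_iff hc0 hc1, mul_comm c] at key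
  exact key

lemma trunc_bound (σ p q : ℝ) (hσ0 : 0 < σ) (hσ1 : σ < 1) (hp : p = 2 / (2 - σ)) (hq : q = 2 / σ)
    (f u : ℝ → ℝ≥0∞) (hf : Measurable f) (hu : Measurable u)
    (hF : ∫⁻ x, f x ^ p ≤ 1) (hle : ∀ x, u x ≤ op σ f x) (hfin : ∫⁻ x, u x ^ q ≠ ∞) :
    ∫⁻ x, u x ^ q ≤ (ENNReal.ofReal (2 / (1 - σ) + 1) *
      (ENNReal.ofReal (1 / (p - 1)) + ENNReal.ofReal (1 / (p - 1)))) ^ q := by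
  set D := ENNReal.ofReal (2 / (1 - σ) + 1) *
      (ENNReal.ofReal (1 / (p - 1)) + ENNReal.ofReal (1 / (p - 1)))
  rcases eq_or_ne (∫⁻ x, u x ^ q) 0 with h0 | h0
  · rw [h0]; exact zero_le
  have h2 : 0 < 2 - σ := by linarith
  have hq1 : 0 < q - 1 := by
    have : q - 1 = (2 - σ) / σ := by rw [hq]; field_simp
    rw [this]; positivity
  have hqp : (q - 1) * p = q := by rw [hp, hq]; field_simp
  have hpq : 1 / p + 1 / q = 1 := by rw [hp, hq]; field_simp; ring
  set N := ∫⁻ x, u x ^ q with hN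
  have key := bilin_scaled σ p hσ0 hσ1 hp f (fun x => u x ^ (q - 1)) hf (hu.pow_const _) hF N h0 hfin
    (by simp_rw [← ENNReal.rpow_mul, hqp]; exact le_rfl)
  have h3 : N ≤ D * N ^ (1 / p) := by
    refine le_trans ?_ key
    apply lintegral_mono
    intro x
    have : u x ^ q = u x ^ (q - 1) * u x := by
      conv_rhs => rw [← ENNReal.rpow_one (u x), ← ENNReal.rpow_mul, one_mul]
      rw [← ENNReal.rpow_add_of_nonneg _ _ hq1.le zero_le_one, sub_add_cancel]
    simp only [this]
    gcongr
    exact hle x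
  have hc0 : N ^ (1 / p) ≠ 0 := by simp [h0, hfin]
  have hp0 : 0 < p := by rw [hp]; positivity
  have hc1 : N ^ (1 / p) ≠ ∞ := ENNReal.rpow_ne_top_of_nonneg (by positivity) hfin
  have h4 : N ^ (1 / q) ≤ D := by
    have : N = N ^ (1 / q) * N ^ (1 / p) := by
      rw [← ENNReal.rpow_add _ _ h0 hfin, add_comm, hpq, ENNReal.rpow_one]
    nth_rewrite 1 [this] at h3
    exact (ENNReal.mul_le_mul_iff_left hc0 hc1).1 h3
  have hq0 : 0 < q := by linarith
  calc N = (N ^ (1 / q)) ^ q := by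
        rw [← ENNReal.rpow_mul, one_div_mul_cancel hq0.ne', ENNReal.rpow_one]
    _ ≤ _ := ENNReal.rpow_le_rpow h4 hq0.le

lemma hls_unit (σ p q : ℝ) (hσ0 : 0 < σ) (hσ1 : σ < 1) (hp : p = 2 / (2 - σ)) (hq : q = 2 / σ)
    (f : ℝ → ℝ≥0∞) (hf : Measurable f) (hF : ∫⁻ x, f x ^ p ≤ 1) :
    ∫⁻ x, op σ f x ^ q ≤ (ENNReal.ofReal (2 / (1 - σ) + 1) *
      (ENNReal.ofReal (1 / (p - 1)) + ENNReal.ofReal (1 / (p - 1)))) ^ q := by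
  have hq0 : 0 < q := by rw [hq]; positivity
  have hT := measurable_op σ f hf
  set u : ℕ → ℝ → ℝ≥0∞ := fun n =>
    (Set.Icc (-(n:ℝ)) n).indicator (fun x => min (op σ f x) n) with hu
  have hum : ∀ n, Measurable (u n) := fun n =>
    (hT.min measurable_const).indicator measurableSet_Icc
  have hb : ∀ n, ∫⁻ x, u n x ^ q ≤ (ENNReal.ofReal (2 / (1 - σ) + 1) *
      (ENNReal.ofReal (1 / (p - 1)) + ENNReal.ofReal (1 / (p - 1)))) ^ q := by
    intro n
    apply trunc_bound σ p q hσ0 hσ1 hp hq f (u n) hf (hum n) hF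
    · intro x
      exact (Set.indicator_le_self _ _ x).trans (min_le_left _ _)
    · have : ∫⁻ x, u n x ^ q ≤ ∫⁻ x, (Set.Icc (-(n:ℝ)) n).indicator (fun _ => (n:ℝ≥0∞) ^ q) x := by
        apply lintegral_mono
        intro x
        by_cases hx : x ∈ Set.Icc (-(n:ℝ)) n
        · simp only [hu, Set.indicator_of_mem hx]
          exact ENNReal.rpow_le_rpow (min_le_right _ _) hq0.le
        · simp only [hu, Set.indicator_of_notMem hx, ENNReal.zero_rpow_of_pos hq0, le_refl]
      refine ne_top_of_le_ne_top ?_ this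
      rw [lintegral_indicator_const measurableSet_Icc, Real.volume_Icc]
      exact ENNReal.mul_ne_top (ENNReal.rpow_ne_top_of_nonneg hq0.le (by simp)) (by simp)
  have hmono : ∀ x, Monotone fun n => u n x := by
    intro x m n hmn
    have hmn' : (m:ℝ) ≤ n := by exact_mod_cast hmn
    by_cases hx : x ∈ Set.Icc (-(m:ℝ)) m
    · have hx' : x ∈ Set.Icc (-(n:ℝ)) n := ⟨by linarith [hx.1], by linarith [hx.2]⟩
      simp only [hu, Set.indicator_of_mem hx, Set.indicator_of_mem hx']
      gcongr
    · simp [hu, Set.indicator_of_notMem hx]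
  have hsup : ∀ x, op σ f x ^ q ≤ ⨆ n, u n x ^ q := by
    intro x
    apply le_of_forall_lt
    intro c hc
    have h1 : c ^ (1 / q) < op σ f x := by
      have := ENNReal.rpow_lt_rpow hc (one_div_pos.2 hq0)
      rwa [← ENNReal.rpow_mul, mul_one_div_cancel hq0.ne', ENNReal.rpow_one] at this
    obtain ⟨n1, hn1⟩ := ENNReal.exists_nat_gt (ne_top_of_lt h1)
    obtain ⟨n2, hn2⟩ := exists_nat_gt |x|
    refine lt_of_lt_of_le ?_ (le_iSup _ (max n1 n2))
    have hx : x ∈ Set.Icc (-((max n1 n2 : ℕ):ℝ)) (max n1 n2 : ℕ) := by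
      have : |x| ≤ ((max n1 n2 : ℕ):ℝ) := hn2.le.trans (by exact_mod_cast le_max_right _ _)
      exact abs_le.1 this
    have h2 : c ^ (1 / q) < u (max n1 n2) x := by
      simp only [hu, Set.indicator_of_mem hx]
      refine lt_min h1 (hn1.trans_le (by exact_mod_cast le_max_left _ _))
    have := ENNReal.rpow_lt_rpow h2 hq0
    rwa [← ENNReal.rpow_mul, one_div_mul_cancel hq0.ne', ENNReal.rpow_one] at this
  calc _ ≤ ∫⁻ x, ⨆ n, u n x ^ q := lintegral_mono hsup
    _ = ⨆ n, ∫⁻ x, u n x ^ q := lintegral_iSup (fun n => (hum n).pow_const _)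
        (fun m n hmn x => ENNReal.rpow_le_rpow (hmono x hmn) hq0.le)
    _ ≤ _ := iSup_le hb

lemma hls_norm (σ p q : ℝ) (hσ0 : 0 < σ) (hσ1 : σ < 1) (hp : p = 2 / (2 - σ)) (hq : q = 2 / σ)
    (f : ℝ → ℝ≥0∞) (hf : Measurable f) :
    (∫⁻ x, op σ f x ^ q) ^ (1 / q) ≤ (ENNReal.ofReal (2 / (1 - σ) + 1) *
      (ENNReal.ofReal (1 / (p - 1)) + ENNReal.ofReal (1 / (p - 1)))) *
      (∫⁻ x, f x ^ p) ^ (1 / p) := by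
  have hq0 : 0 < q := by rw [hq]; positivity
  have h2 : 0 < 2 - σ := by linarith
  have hp1 : p - 1 = σ / (2 - σ) := by rw [hp]; field_simp; ring
  have hpp : 0 < p - 1 := by rw [hp1]; positivity
  have hp0 : 0 < p := by linarith
  have hs : 0 < 1 - σ := by linarith
  have hunit := hls_unit σ p q hσ0 hσ1 hp hq
  have hD : ENNReal.ofReal (2 / (1 - σ) + 1) *
      (ENNReal.ofReal (1 / (p - 1)) + ENNReal.ofReal (1 / (p - 1))) ≠ 0 := by
    rw [← ENNReal.ofReal_add (by positivity) (by positivity), ← ENNReal.ofReal_mul (by positivity)]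
    have : 0 < (2 / (1 - σ) + 1) * (1 / (p - 1) + 1 / (p - 1)) := by positivity
    simpa only [ne_eq, ENNReal.ofReal_eq_zero, not_le] using this
  set D := ENNReal.ofReal (2 / (1 - σ) + 1) *
      (ENNReal.ofReal (1 / (p - 1)) + ENNReal.ofReal (1 / (p - 1)))
  rcases eq_or_ne (∫⁻ x, f x ^ p) 0 with h0 | h0
  · have hz : op σ f = fun _ => 0 := by
      funext y
      rw [lintegral_eq_zero_iff (hf.pow_const _)] at h0
      unfold op
      rw [lintegral_eq_zero_iff]
      · filter_upwards [h0] with x hx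
        have : f x = 0 := by simpa [hp0, hp0.not_gt] using hx
        simp [this]
      · exact hf.mul ((measurable_ker σ).comp (measurable_id.sub measurable_const))
    simp [hz, hq0]
  rcases eq_or_ne (∫⁻ x, f x ^ p) ∞ with h1 | h1
  · rw [h1, ENNReal.top_rpow_of_pos (by positivity), ENNReal.mul_top hD]
    exact le_top
  set N := ∫⁻ x, f x ^ p
  have hc0 : N ^ (1 / p) ≠ 0 := by simp [h0, h1]
  have hc1 : N ^ (1 / p) ≠ ∞ := ENNReal.rpow_ne_top_of_nonneg (by positivity) h1
  have hcp : (N ^ (1 / p)) ^ p = N := by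
    rw [← ENNReal.rpow_mul, one_div_mul_cancel hp0.ne', ENNReal.rpow_one]
  set c := N ^ (1 / p)
  have key := hunit (fun x => c⁻¹ * f x) (hf.const_mul _) (by
    simp_rw [ENNReal.mul_rpow_of_nonneg _ _ hp0.le]
    rw [lintegral_const_mul _ (hf.pow_const _), ENNReal.inv_rpow, hcp]
    exact (ENNReal.inv_mul_cancel h0 h1).le)
  have hop : ∀ y, op σ (fun x => c⁻¹ * f x) y = c⁻¹ * op σ f y := by
    intro y
    unfold op
    rw [← lintegral_const_mul]
    · simp_rw [mul_assoc]
    · exact hf.mul ((measurable_ker σ).comp (measurable_id.sub measurable_const))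
  simp_rw [hop, ENNReal.mul_rpow_of_nonneg _ _ hq0.le] at key
  rw [lintegral_const_mul _ ((measurable_op σ f hf).pow_const _)] at key
  have key2 := ENNReal.rpow_le_rpow key (one_div_pos.2 hq0).le
  rw [ENNReal.mul_rpow_of_nonneg _ _ (one_div_pos.2 hq0).le, ← ENNReal.rpow_mul, ← ENNReal.rpow_mul,
    mul_one_div_cancel hq0.ne', ENNReal.rpow_one, ENNReal.rpow_one,
    ENNReal.inv_mul_le_iff hc0 hc1, mul_comm c] at key2
  exact key2

lemma hls_outer (σ : ℝ) (hσ0 : 0 ≤ σ) (hσ1 : σ < 1) : ∃ C : ℝ, 0 < C ∧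
    ∀ f : ℝ → ℝ≥0∞, Measurable f → outerNorm (2 / ENNReal.ofReal σ) (op σ f) ≤
      ENNReal.ofReal C * outerNorm (ENNReal.ofReal (2 / (2 - σ))) f := by
  have h2 : 0 < 2 - σ := by linarith
  rcases hσ0.eq_or_lt with rfl | hpos
  · refine ⟨1, one_pos, fun f hf => ?_⟩
    simp only [outerNorm, ENNReal.ofReal_zero, ENNReal.div_zero two_ne_zero, if_true,
      ENNReal.ofReal_ne_top, if_false]
    have : op 0 f = fun _ => ∫⁻ x, f x := by
      funext y; simp [op, ker]
    rw [this]
    simp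
  · have hs : 0 < 1 - σ := by linarith
    refine ⟨(2 / (1 - σ) + 1) * (1 / (2 / (2 - σ) - 1) + 1 / (2 / (2 - σ) - 1)), ?_, fun f hf => ?_⟩
    · have hp1 : 2 / (2 - σ) - 1 = σ / (2 - σ) := by field_simp; ring
      rw [hp1]; positivity
    · have hp1 : 2 / (2 - σ) - 1 = σ / (2 - σ) := by field_simp; ring
      have hpp : 0 < 2 / (2 - σ) - 1 := by rw [hp1]; positivity
      have key := hls_norm σ _ _ hpos hσ1 rfl rfl f hf
      have e1 : 2 / ENNReal.ofReal σ ≠ ∞ := by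
        apply ENNReal.div_ne_top (by simp) (by simpa using hpos)
      have e2 : (2 / ENNReal.ofReal σ).toReal = 2 / σ := by
        rw [ENNReal.toReal_div, ENNReal.toReal_ofReal hpos.le]; simp
      rw [outerNorm, outerNorm, if_neg e1, if_neg ENNReal.ofReal_ne_top, e2,
        ENNReal.toReal_ofReal (by positivity), ENNReal.ofReal_mul (by positivity),
        ENNReal.ofReal_add (p := 1 / (2 / (2 - σ) - 1)) (by positivity) (by positivity)]
      exact key

lemma outerNorm_mono (p : ℝ≥0∞) (g h : ℝ → ℝ≥0∞) (hgh : ∀ x, g x ≤ h x) :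
    outerNorm p g ≤ outerNorm p h := by
  unfold outerNorm
  split_ifs with hp
  · exact essSup_mono_ae (Filter.Eventually.of_forall hgh)
  · apply ENNReal.rpow_le_rpow _ (by positivity)
    apply lintegral_mono
    intro x
    exact ENNReal.rpow_le_rpow (hgh x) (by positivity)

lemma outerNorm_const_mul (p : ℝ≥0∞) (hp0 : p ≠ 0) (c : ℝ≥0∞) (g : ℝ → ℝ≥0∞) (hg : Measurable g) :
    outerNorm p (fun x => c * g x) = c * outerNorm p g := by
  unfold outerNorm
  split_ifs with hp
  · exact ENNReal.essSup_const_mul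
  · have h : 0 < p.toReal := ENNReal.toReal_pos hp0 hp
    simp_rw [ENNReal.mul_rpow_of_nonneg _ _ h.le]
    rw [lintegral_const_mul _ (hg.pow_const _), ENNReal.mul_rpow_of_nonneg _ _ (by positivity),
      ← ENNReal.rpow_mul, mul_one_div_cancel h.ne', ENNReal.rpow_one]

lemma conv_bound (σ : ℝ) (K : ℝ × ℝ × ℝ → ℂ) (A : ℝ) (hA : 0 ≤ A)
    (hK : ∀ x : ℝ × ℝ × ℝ, ‖K x‖ ≤ A * (1 + |x.2.2|) ^ (-σ))
    (f : ℝ × ℝ × ℝ → ℂ) (hf : Measurable f) (x : ℝ × ℝ × ℝ) :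
    ‖∫ y : ℝ × ℝ × ℝ, f (x - y) * K y‖ₑ ≤ ENNReal.ofReal A *
      op σ (fun x₃ => eLpNorm (fun y : ℝ × ℝ => f (y.1, y.2, x₃)) 1 volume) x.2.2 := by
  have hfe : Measurable fun z => ‖f z‖ₑ := hf.enorm
  have hk := measurable_ker σ
  calc ‖∫ y : ℝ × ℝ × ℝ, f (x - y) * K y‖ₑ ≤ ∫⁻ y : ℝ × ℝ × ℝ, ‖f (x - y) * K y‖ₑ :=
        enorm_integral_le_lintegral_enorm _
    _ ≤ ∫⁻ y : ℝ × ℝ × ℝ, ENNReal.ofReal A * (‖f (x - y)‖ₑ * ker σ y.2.2) := by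
        apply lintegral_mono
        intro y
        have : ‖K y‖ₑ ≤ ENNReal.ofReal A * ker σ y.2.2 := by
          rw [ker, ← ENNReal.ofReal_mul hA, ← ofReal_norm]
          exact ENNReal.ofReal_le_ofReal (hK y)
        simp only [enorm_mul]
        calc _ ≤ ‖f (x - y)‖ₑ * (ENNReal.ofReal A * ker σ y.2.2) := by gcongr
          _ = _ := by ring
    _ = ∫⁻ y : ℝ × ℝ × ℝ, ENNReal.ofReal A * (‖f y‖ₑ * ker σ (x - y).2.2) := by
        have i1 : (volume : Measure (ℝ × ℝ × ℝ)).IsAddHaarMeasure := by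
          have i2 : (volume : Measure (ℝ × ℝ)).IsAddHaarMeasure := by
            rw [Measure.volume_eq_prod]; infer_instance
          rw [Measure.volume_eq_prod]; infer_instance
        rw [← lintegral_sub_left_eq_self _ x]
        simp
    _ = ENNReal.ofReal A * ∫⁻ y : ℝ × ℝ × ℝ, (‖f y‖ₑ * ker σ (x - y).2.2) := by
        rw [lintegral_const_mul]
        exact hfe.mul (hk.comp (by fun_prop))
    _ = _ := by
        congr 1
        have hm : Measurable fun y : ℝ × ℝ × ℝ => ‖f y‖ₑ * ker σ (x - y).2.2 :=
          hfe.mul (hk.comp (by fun_prop))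
        have hm2 : Measurable fun z : (ℝ × ℝ) × ℝ =>
            ‖f (z.1.1, z.1.2, z.2)‖ₑ * ker σ (x.2.2 - z.2) :=
          (hfe.comp (by fun_prop)).mul (hk.comp (by fun_prop))
        rw [Measure.volume_eq_prod, lintegral_prod _ hm.aemeasurable]
        calc _ = ∫⁻ a : ℝ, ∫⁻ b : ℝ, ∫⁻ t : ℝ, ‖f (a, b, t)‖ₑ * ker σ (x.2.2 - t) := by
              apply lintegral_congr; intro a
              rw [Measure.volume_eq_prod, lintegral_prod]
              · rfl
              · exact (hm.comp measurable_prodMk_left).aemeasurable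
          _ = ∫⁻ z : ℝ × ℝ, ∫⁻ t : ℝ, ‖f (z.1, z.2, t)‖ₑ * ker σ (x.2.2 - t) := by
              rw [Measure.volume_eq_prod, lintegral_prod]
              exact (Measurable.lintegral_prod_right' hm2).aemeasurable
          _ = ∫⁻ t : ℝ, ∫⁻ z : ℝ × ℝ, ‖f (z.1, z.2, t)‖ₑ * ker σ (x.2.2 - t) :=
              lintegral_lintegral_swap hm2.aemeasurable
          _ = _ := by
              unfold op
              apply lintegral_congr; intro t
              have hm3 : Measurable fun z : ℝ × ℝ => ‖f (z.1, z.2, t)‖ₑ := hfe.comp (by fun_prop)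
              rw [lintegral_mul_const _ hm3]
              beta_reduce
              rw [eLpNorm_one_eq_lintegral_enorm,
                ← ker_neg, neg_sub]

lemma measurable_slice (f : ℝ × ℝ × ℝ → ℂ) (hf : Measurable f) :
    Measurable fun x₃ : ℝ => eLpNorm (fun y : ℝ × ℝ => f (y.1, y.2, x₃)) 1 volume := by
  simp_rw [eLpNorm_one_eq_lintegral_enorm]
  apply Measurable.lintegral_prod_left' (f := fun z : (ℝ × ℝ) × ℝ => ‖f (z.1.1, z.1.2, z.2)‖ₑ)
  exact hf.enorm.comp (by fun_prop)

end HLS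

/-- Mixed-norm convolution estimate from kernel decay: if
`|K(x)| ≤ A (1+|x₃|)^{-σ}` with `σ ∈ [0,1)`, then `f ↦ f * K` maps
`L^{2/(2−σ)}_{x₃}(L¹)` to `L^{2/σ}_{x₃}(L^∞)` with norm `≲ A`. -/
theorem stmt_6 (σ : ℝ) (hσ0 : 0 ≤ σ) (hσ1 : σ < 1) :
    ∃ C : ℝ, 0 < C ∧
      ∀ (K : ℝ × ℝ × ℝ → ℂ) (A : ℝ), Measurable K →
        (∀ x : ℝ × ℝ × ℝ, ‖K x‖ ≤ A * (1 + |x.2.2|) ^ (-σ)) →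
        ∀ f : SchwartzMap (ℝ × ℝ × ℝ) ℂ,
          mixedNorm ∞ (2 / ENNReal.ofReal σ)
              (fun x => ∫ y : ℝ × ℝ × ℝ, f (x - y) * K y) ≤
            ENNReal.ofReal (C * A) *
              mixedNorm 1 (ENNReal.ofReal (2 / (2 - σ))) (fun x => f x) := by
  obtain ⟨C, hC, hCb⟩ := HLS.hls_outer σ hσ0 hσ1
  refine ⟨C, hC, fun K A _ hK f => ?_⟩
  have hA : 0 ≤ A := by
    have := (norm_nonneg _).trans (hK 0)
    simpa using this
  have hf : Measurable (fun x => f x) := f.continuous.measurable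
  have hg := HLS.measurable_slice (fun x => f x) hf
  unfold mixedNorm
  refine (HLS.outerNorm_mono _ _ (fun x₃ => ENNReal.ofReal A * HLS.op σ
    (fun x₃ => eLpNorm (fun y : ℝ × ℝ => f (y.1, y.2, x₃)) 1 volume) x₃) ?_).trans ?_
  · intro x₃
    rw [eLpNorm_exponent_top]
    apply eLpNormEssSup_le_of_ae_enorm_bound
    exact Filter.Eventually.of_forall
      (fun y => HLS.conv_bound σ K A hA hK (fun x => f x) hf (y.1, y.2, x₃))
  · rw [HLS.outerNorm_const_mul _ (by simp) _ _ (HLS.measurable_op σ _ hg), mul_comm C,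
      ENNReal.ofReal_mul hA, mul_assoc]
    gcongr
    exact hCb _ hg
end

section
/- Frequency-localized mixed-norm bound: Let μ be a tempered Radon measure on ℝ³ such that both μ and ℱμ are measurable functions with ‖ℱμ‖_{L^∞} ≤ A and ‖μ‖_{L^∞} ≤ B, and assume supp ℱμ ⊂ ℝ² × [−λ₃, λ₃] for some λ₃ ≥ 1. Then for every σ̃ ∈ [0,1), the convolution operator T f = f * ℱμ is bounded from L^{2/(2−σ̃)}_{x₃}(L¹_{(x₁,x₂)}) to L^{2/σ̃}_{x₃}(L^∞_{(x₁,x₂)}) with norm ≲ A λ₃^{σ̃}, and T is bounded on L²(ℝ³) with norm ≲ B. -/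
open MeasureTheory
open scoped ENNReal

/-- The Fourier transform on `ℝ³`. -/
noncomputable def ft3 (m : ℝ × ℝ × ℝ → ℂ) (ξ : ℝ × ℝ × ℝ) : ℂ :=
  ∫ x : ℝ × ℝ × ℝ,
    Complex.exp (-2 * Real.pi * Complex.I *
      ((x.1 * ξ.1 + x.2.1 * ξ.2.1 + x.2.2 * ξ.2.2 : ℝ) : ℂ)) * m x


open FourierTransform SchwartzMap in
theorem aux_plancherel (g : EuclideanSpace ℝ (Fin 3) → ℂ) (h1 : Integrable g) (h2 : MemLp g 2 volume) :
    eLpNorm (𝓕 g) 2 volume = eLpNorm g 2 volume := by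
  let G : Lp ℂ 2 (volume : Measure (EuclideanSpace ℝ (Fin 3))) := h2.toLp g
  have hcont : Continuous (𝓕 g) :=
    VectorFourier.fourierIntegral_continuous Real.continuous_fourierChar
      (by exact continuous_inner) h1
  have key : (𝓕 G : Lp ℂ 2 (volume : Measure (EuclideanSpace ℝ (Fin 3)))) =ᵐ[volume] 𝓕 g := by
    apply ae_eq_of_integral_contDiff_smul_eq
    · exact (Lp.memLp _).locallyIntegrable (by norm_num)
    · exact hcont.locallyIntegrable
    · intro φ φs φc
      have hg₁ : HasCompactSupport (Complex.ofRealCLM ∘ φ) := φc.comp_left rfl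
      have hg₂ : ContDiff ℝ (⊤ : ℕ∞) (Complex.ofRealCLM ∘ φ) := by fun_prop
      let Φ := hg₁.toSchwartzMap hg₂
      have e1 : ∫ x, φ x • (𝓕 G : Lp ℂ 2 (volume : Measure (EuclideanSpace ℝ (Fin 3)))) x
          = Lp.toTemperedDistribution (𝓕 G) Φ := by
        simp [Φ]
      rw [e1, ← Lp.fourier_toTemperedDistribution_eq, TemperedDistribution.fourier_apply,
        Lp.toTemperedDistribution_apply]
      have e2 : ∫ x, (𝓕 Φ) x • G x = ∫ x, (𝓕 Φ) x • g x := by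
        apply integral_congr_ae
        filter_upwards [h2.coeFn_toLp] with x hx
        rw [hx]
      rw [e2]
      have e3 := VectorFourier.integral_fourierIntegral_smul_eq_flip (μ := volume) (ν := volume)
        (L := innerₗ (EuclideanSpace ℝ (Fin 3))) Real.continuous_fourierChar
        (by exact continuous_inner) (Φ.integrable (μ := volume)) h1
      rw [flip_innerₗ] at e3
      rw [SchwartzMap.fourier_coe]
      refine e3.trans ?_
      apply integral_congr_ae
      filter_upwards with x
      simp only [Φ, HasCompactSupport.toSchwartzMap_toFun, Function.comp, Complex.ofRealCLM_apply, Complex.real_smul, smul_eq_mul]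
      rfl
  rw [← eLpNorm_congr_ae key, ← eLpNorm_congr_ae h2.coeFn_toLp]
  have := Lp.norm_fourier_eq G
  rw [Lp.norm_def, Lp.norm_def, ENNReal.toReal_eq_toReal_iff' (Lp.eLpNorm_ne_top _) (Lp.eLpNorm_ne_top _)] at this
  exact this

open FourierTransform SchwartzMap in
theorem aux_L2E (n : EuclideanSpace ℝ (Fin 3) → ℂ) (B : ℝ) (hn : Integrable n)
    (hB : ∀ x, ‖n x‖ ≤ B) (f : 𝓢(EuclideanSpace ℝ (Fin 3), ℂ)) :
    eLpNorm (fun x => ∫ y, f (x - y) * 𝓕 n y) 2 volume ≤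
      ENNReal.ofReal B * eLpNorm f 2 volume := by
  have hB0 : 0 ≤ B := (norm_nonneg _).trans (hB 0)
  have hbd : ∀ᵐ x, ‖(n * ⇑(𝓕⁻ f : 𝓢(EuclideanSpace ℝ (Fin 3), ℂ))) x‖ ≤ 
      B * ‖(𝓕⁻ f : 𝓢(EuclideanSpace ℝ (Fin 3), ℂ)) x‖ := by
    filter_upwards with x
    rw [Pi.mul_apply, norm_mul]
    gcongr
    exact hB x
  have hmeas : AEStronglyMeasurable (n * ⇑(𝓕⁻ f : 𝓢(EuclideanSpace ℝ (Fin 3), ℂ))) volume :=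
    hn.aestronglyMeasurable.mul (SchwartzMap.continuous _).aestronglyMeasurable
  have h1 : Integrable (n * ⇑(𝓕⁻ f : 𝓢(EuclideanSpace ℝ (Fin 3), ℂ))) := 
    ((𝓕⁻ f : 𝓢(EuclideanSpace ℝ (Fin 3), ℂ)).integrable.norm.const_mul B).mono' hmeas hbd
  have h2 : MemLp (n * ⇑(𝓕⁻ f : 𝓢(EuclideanSpace ℝ (Fin 3), ℂ))) 2 volume :=
    ((𝓕⁻ f : 𝓢(EuclideanSpace ℝ (Fin 3), ℂ)).memLp 2).of_le_mul hmeas hbd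
  have hconv : (fun x => ∫ y, f (x - y) * 𝓕 n y) =
      𝓕 (n * ⇑(𝓕⁻ f : 𝓢(EuclideanSpace ℝ (Fin 3), ℂ))) := by
    ext x
    have hf : Integrable (fun y => f (x - y)) volume := 
      (f.integrable (μ := volume)).comp_sub_left x
    have e3 := VectorFourier.integral_fourierIntegral_smul_eq_flip (μ := volume) (ν := volume)
        (L := innerₗ (EuclideanSpace ℝ (Fin 3))) Real.continuous_fourierChar
        (by exact continuous_inner) hn hf
    rw [flip_innerₗ] at e3
    calc _ = ∫ y, 𝓕 n y • f (x - y) := by simp [mul_comm]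
      _ = ∫ z, n z • 𝓕 (fun y => f (x - y)) z := e3
      _ = _ := by
        rw [Real.fourier_eq']
        apply integral_congr_ae
        filter_upwards with z
        rw [Pi.mul_apply, SchwartzMap.fourierInv_coe, Real.fourierInv_eq', Real.fourier_eq',
          ← integral_sub_left_eq_self _ volume x]
        simp only [smul_eq_mul]
        rw [mul_left_comm]
        congr 1
        rw [← integral_const_mul]
        apply integral_congr_ae
        filter_upwards with y
        rw [← mul_assoc, ← Complex.exp_add, sub_sub_cancel]
        congr 2
        rw [inner_sub_left, real_inner_comm x z]
        push_cast
        ring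
  rw [hconv, aux_plancherel _ h1 h2]
  have h3 := eLpNorm_le_mul_eLpNorm_of_ae_le_mul hbd 2
  have h4 : eLpNorm (𝓕⁻ f : 𝓢(EuclideanSpace ℝ (Fin 3), ℂ)) 2 volume = eLpNorm f 2 volume := by
    rw [← aux_plancherel _ (SchwartzMap.integrable _) (SchwartzMap.memLp _ 2 volume),
      ← SchwartzMap.fourier_coe, fourier_fourierInv_eq]
  rw [h4] at h3
  exact h3

noncomputable def auxE : (ℝ × ℝ × ℝ) ≃L[ℝ] EuclideanSpace ℝ (Fin 3) :=
  LinearEquiv.toContinuousLinearEquiv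
  { toFun := fun x => !₂[x.1, x.2.1, x.2.2]
    invFun := fun v => (v 0, v 1, v 2)
    map_add' := by
      intro x y; ext i; fin_cases i <;> simp
    map_smul' := by
      intro c x; ext i; fin_cases i <;> simp
    left_inv := by intro x; simp
    right_inv := by intro x; ext i; fin_cases i <;> simp }

theorem auxE_apply (x : ℝ × ℝ × ℝ) : auxE x = !₂[x.1, x.2.1, x.2.2] := rfl

theorem auxE_symm_mp : MeasurePreserving auxE.symm volume volume := by
  have h1 := volume_preserving_piFinSuccAbove (fun _ : Fin 3 => ℝ) 0
  have h2 := (MeasurePreserving.id (volume : Measure ℝ)).prod (volume_preserving_finTwoArrow ℝ)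
  have h3 := (h2.comp h1).comp (PiLp.volume_preserving_ofLp (Fin 3))
  exact h3

theorem auxE_mp : MeasurePreserving auxE volume volume :=
  MeasurePreserving.symm (auxE.symm.toHomeomorph.toMeasurableEquiv) auxE_symm_mp

open FourierTransform SchwartzMap in
theorem aux_ft3 (m : ℝ × ℝ × ℝ → ℂ) (ξ : ℝ × ℝ × ℝ) : ft3 m ξ = 𝓕 (m ∘ auxE.symm) (auxE ξ) := by
  have hemb : MeasurableEmbedding auxE := auxE.toHomeomorph.measurableEmbedding
  rw [Real.fourier_eq', ← auxE_mp.integral_comp hemb, ft3]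
  congr 1
  ext x
  simp only [Function.comp, ContinuousLinearEquiv.symm_apply_apply, smul_eq_mul]
  congr 2
  simp [auxE_apply, Fin.sum_univ_three, PiLp.inner_apply]
  ring

theorem aux_ft3_ni (m : ℝ × ℝ × ℝ → ℂ) (hm : Measurable m) (h : ¬ Integrable m) (ξ : ℝ × ℝ × ℝ) :
    ft3 m ξ = 0 := by
  apply integral_undef
  intro h'
  apply h
  rw [← integrable_norm_iff hm.aestronglyMeasurable]
  refine h'.norm.congr ?_
  filter_upwards with x
  rw [norm_mul]
  have : ‖Complex.exp (-2 * Real.pi * Complex.I *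
      ((x.1 * ξ.1 + x.2.1 * ξ.2.1 + x.2.2 * ξ.2.2 : ℝ) : ℂ))‖ = 1 := by
    rw [Complex.norm_exp]
    simp
  rw [this, one_mul]

open FourierTransform SchwartzMap in
theorem aux_L2 (m : ℝ × ℝ × ℝ → ℂ) (B : ℝ) (hm : Measurable m)
    (hB : ∀ x, ‖m x‖ ≤ B) (f : 𝓢(ℝ × ℝ × ℝ, ℂ)) :
    eLpNorm (fun x => ∫ y : ℝ × ℝ × ℝ, f (x - y) * ft3 m y) 2 volume ≤
      ENNReal.ofReal B * eLpNorm (fun x => f x) 2 volume := by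
  by_cases hi : Integrable m
  swap
  · simp [aux_ft3_ni m hm hi]
  have hemb : MeasurableEmbedding auxE := auxE.toHomeomorph.measurableEmbedding
  have hi' : Integrable (m ∘ auxE.symm) := 
    auxE_symm_mp.integrable_comp_of_integrable hi
  have := aux_L2E (m ∘ auxE.symm) B hi' (fun x => hB _) 
    (compCLMOfContinuousLinearEquiv ℂ auxE.symm f)
  rw [← eLpNorm_comp_measurePreserving (ν := volume) (f := auxE)  _ auxE_mp,
    ← eLpNorm_comp_measurePreserving (ν := volume) (f := auxE) _ auxE_mp] at this
  · convert this using 2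
    · ext x
      simp only [Function.comp]
      rw [← auxE_mp.integral_comp hemb]
      congr 1
      ext y
      rw [aux_ft3]
      simp [Function.comp_def]
    · simp [Function.comp_def]
  · exact (SchwartzMap.continuous _).aestronglyMeasurable
  · have hc : Continuous (𝓕 (m ∘ auxE.symm)) := VectorFourier.fourierIntegral_continuous Real.continuous_fourierChar
      (by exact continuous_inner) hi'
    apply StronglyMeasurable.aestronglyMeasurable
    apply StronglyMeasurable.integral_prod_right (f := fun x y : EuclideanSpace ℝ (Fin 3) => (compCLMOfContinuousLinearEquiv ℂ auxE.symm f) (x - y) * 𝓕 (m ∘ auxE.symm) y)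
    apply Continuous.stronglyMeasurable
    unfold Function.uncurry
    have := (compCLMOfContinuousLinearEquiv ℂ auxE.symm f).continuous
    fun_prop

theorem aux_meas (g : ℝ → ℝ≥0∞) (hg : Measurable g) (L : ℝ) :
    Measurable (fun p : ℝ × ℝ => (Metric.closedBall p.1 L).indicator g p.2) := by
  have hS : MeasurableSet {p : ℝ × ℝ | dist p.2 p.1 ≤ L} :=
    measurableSet_le (by fun_prop) measurable_const
  have : (fun p : ℝ × ℝ => (Metric.closedBall p.1 L).indicator g p.2) =
      {p : ℝ × ℝ | dist p.2 p.1 ≤ L}.indicator (fun p => g p.2) := by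
    ext p
    simp [Set.indicator, Metric.mem_closedBall]
  rw [this]
  exact (hg.comp measurable_snd).indicator hS

theorem aux_int_ball (g : ℝ → ℝ≥0∞) (hg : Measurable g) (L : ℝ) :
    ∫⁻ x, ∫⁻ u in Metric.closedBall x L, g u = ENNReal.ofReal (2 * L) * ∫⁻ u, g u := by
  simp_rw [← lintegral_indicator Metric.isClosed_closedBall.measurableSet]
  rw [lintegral_lintegral_swap (aux_meas g hg L).aemeasurable, ← lintegral_const_mul _ hg]
  congr 1
  ext u
  have : ∀ x, (Metric.closedBall x L).indicator g u =
      (Metric.closedBall u L).indicator (fun _ => g u) x := by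
    intro x
    simp [Set.indicator, Metric.mem_closedBall, dist_comm]
  simp_rw [this]
  rw [lintegral_indicator Metric.isClosed_closedBall.measurableSet, setLIntegral_const,
    Real.volume_closedBall, mul_comm]

theorem aux_meas' (g : ℝ → ℝ≥0∞) (hg : Measurable g) (L : ℝ) :
    Measurable (fun x => ∫⁻ u in Metric.closedBall x L, g u) := by
  simp_rw [← lintegral_indicator Metric.isClosed_closedBall.measurableSet]
  exact (aux_meas g hg L).lintegral_prod_right'

theorem aux_young (σ : ℝ) (hσ0 : 0 ≤ σ) (hσ1 : σ < 1) (g : ℝ → ℝ≥0∞) (hg : Measurable g) (L : ℝ)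
    (hL : 0 < L) :
    outerNorm (2 / ENNReal.ofReal σ) (fun x => ∫⁻ u in Metric.closedBall x L, g u) ≤
      ENNReal.ofReal ((2 * L) ^ σ) * outerNorm (ENNReal.ofReal (2 / (2 - σ))) g := by
  rcases hσ0.eq_or_lt with h0 | h0
  · subst h0
    simp only [outerNorm, ENNReal.ofReal_zero, ENNReal.ofReal_ne_top, if_false]
    rw [ENNReal.div_zero (by norm_num), if_pos rfl]
    simp only [sub_zero, Real.rpow_zero, ENNReal.ofReal_one, one_mul]
    norm_num
    refine essSup_le_of_ae_le _ ?_
    filter_upwards with x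
    exact setLIntegral_le_lintegral _ _
  set p : ℝ := 2 / (2 - σ) with hp
  set q : ℝ := 2 / σ with hq
  have hp0 : 0 < p := by apply div_pos <;> linarith
  have hq0 : 0 < q := by apply div_pos <;> linarith
  have hpi : 1 / p = 1 - σ / 2 := by rw [hp]; field_simp
  have hqi : 1 / q = σ / 2 := by rw [hq]; field_simp
  have hpq : p.HolderConjugate q := by
    rw [Real.holderConjugate_iff]
    constructor
    · rw [hp, lt_div_iff₀] <;> linarith
    · rw [← one_div, ← one_div, hpi, hqi]; ring
  have hq' : 2 / ENNReal.ofReal σ = ENNReal.ofReal q := by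
    rw [hq, ENNReal.ofReal_div_of_pos h0]; simp
  rw [hq']
  simp only [outerNorm, ENNReal.ofReal_ne_top, if_false, ENNReal.toReal_ofReal hp0.le,
    ENNReal.toReal_ofReal hq0.le]
  set V := ENNReal.ofReal (2 * L) with hV
  set I := ∫⁻ x, g x ^ p with hI
  have hgp : Measurable (fun x => g x ^ p) := hg.pow_const p
  have hap : 0 ≤ q / p - 1 := by
    have : q / p = q - 1 := hpq.symm.div_conj_eq_sub_one
    have : 2 ≤ q := by rw [hq, le_div_iff₀ h0]; linarith
    linarith
  have key : ∀ x, (∫⁻ u in Metric.closedBall x L, g u) ^ q ≤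
      (I ^ (q / p - 1) * V) * ∫⁻ u in Metric.closedBall x L, g u ^ p := by
    intro x
    have h := ENNReal.lintegral_mul_le_Lp_mul_Lq (volume.restrict (Metric.closedBall x L)) hpq
      hg.aemeasurable (g := fun _ => 1) aemeasurable_const
    simp only [Pi.mul_apply, mul_one, ENNReal.one_rpow, lintegral_one, Measure.restrict_apply_univ,
      Real.volume_closedBall] at h
    calc _ ≤ ((∫⁻ u in Metric.closedBall x L, g u ^ p) ^ (1 / p) * V ^ (1 / q)) ^ q := by
          gcongr
      _ = (∫⁻ u in Metric.closedBall x L, g u ^ p) ^ ((q / p - 1) + 1) * V := by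
          rw [ENNReal.mul_rpow_of_nonneg _ _ hq0.le, ← ENNReal.rpow_mul, ← ENNReal.rpow_mul,
            one_div_mul_cancel hq0.ne', ENNReal.rpow_one]
          congr 2
          ring
      _ ≤ _ := by
          rw [ENNReal.rpow_add_of_nonneg _ _ hap zero_le_one, ENNReal.rpow_one, mul_right_comm]
          gcongr
          exact setLIntegral_le_lintegral _ _
  calc _ ≤ (∫⁻ x, (I ^ (q / p - 1) * V) * ∫⁻ u in Metric.closedBall x L, g u ^ p) ^ (1 / q) := by
        gcongr with x
        exact key x
    _ = ((V ^ (2 : ℝ)) * I ^ (q / p)) ^ (1 / q) := by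
        rw [lintegral_const_mul _ (aux_meas' _ hgp L), aux_int_ball _ hgp]
        congr 1
        have : I ^ (q / p) = I ^ (q / p - 1) * I := by
          conv_rhs => rw [← ENNReal.rpow_one I, ← ENNReal.rpow_mul, one_mul]
          rw [← ENNReal.rpow_add_of_nonneg _ _ hap zero_le_one]
          congr 1; ring
        rw [this, ENNReal.rpow_two]
        ring
    _ = _ := by
        rw [ENNReal.mul_rpow_of_nonneg _ _ (by positivity), ← ENNReal.rpow_mul, ← ENNReal.rpow_mul,
          ← ENNReal.ofReal_rpow_of_pos (by positivity)]
        congr 2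
        · rw [hqi]; ring
        · field_simp

theorem outerNorm_mono (p : ℝ≥0∞) {g h : ℝ → ℝ≥0∞} (H : ∀ x, g x ≤ h x) :
    outerNorm p g ≤ outerNorm p h := by
  unfold outerNorm
  split_ifs
  · exact essSup_mono_ae (Filter.Eventually.of_forall H)
  · have : 0 ≤ p.toReal := ENNReal.toReal_nonneg
    gcongr
    exact H _

theorem outerNorm_const_mul (p : ℝ≥0∞) (hp : p ≠ 0) (c : ℝ≥0∞) (hc : c ≠ ∞) {g : ℝ → ℝ≥0∞} :
    outerNorm p (fun x => c * g x) = c * outerNorm p g := by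
  unfold outerNorm
  split_ifs with h
  · exact ENNReal.essSup_const_mul
  · have : 0 < p.toReal := ENNReal.toReal_pos hp h
    simp_rw [ENNReal.mul_rpow_of_nonneg _ _ this.le]
    rw [lintegral_const_mul' _ _ (by finiteness), ENNReal.mul_rpow_of_nonneg _ _ (by positivity),
      ← ENNReal.rpow_mul, mul_one_div_cancel this.ne', ENNReal.rpow_one]

theorem aux_mixed (σ : ℝ) (hσ0 : 0 ≤ σ) (hσ1 : σ < 1) (K : ℝ × ℝ × ℝ → ℂ) (A L : ℝ) (hL : 1 ≤ L)
    (hA : ∀ ξ, ‖K ξ‖ ≤ A) (hK : ∀ ξ : ℝ × ℝ × ℝ, L < |ξ.2.2| → K ξ = 0)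
    (f : SchwartzMap (ℝ × ℝ × ℝ) ℂ) :
    mixedNorm ∞ (2 / ENNReal.ofReal σ) (fun x => ∫ y : ℝ × ℝ × ℝ, f (x - y) * K y) ≤
      ENNReal.ofReal (2 * A * L ^ σ) *
        mixedNorm 1 (ENNReal.ofReal (2 / (2 - σ))) (fun x => f x) := by
  have hA0 : 0 ≤ A := (norm_nonneg _).trans (hA 0)
  set g : ℝ → ℝ≥0∞ := fun t => eLpNorm (fun y : ℝ × ℝ => f (y.1, y.2, t)) 1 volume with hg
  haveI i1 : (volume : Measure (ℝ × ℝ)).IsAddHaarMeasure :=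
    inferInstanceAs ((volume : Measure ℝ).prod (volume : Measure ℝ)).IsAddHaarMeasure
  haveI i2 : (volume : Measure (ℝ × ℝ × ℝ)).IsAddHaarMeasure :=
    inferInstanceAs ((volume : Measure ℝ).prod (volume : Measure (ℝ × ℝ))).IsAddHaarMeasure
  have hfm : Measurable (fun x => ‖f x‖ₑ) := f.continuous.enorm.measurable
  have hgm : Measurable g := by
    simp_rw [hg, eLpNorm_one_eq_lintegral_enorm]
    apply Measurable.lintegral_prod_right' (f := fun p : ℝ × (ℝ × ℝ) => ‖f (p.2.1, p.2.2, p.1)‖ₑ)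
    exact hfm.comp (by fun_prop)
  have pt : ∀ x : ℝ × ℝ × ℝ, ‖∫ y : ℝ × ℝ × ℝ, f (x - y) * K y‖ₑ ≤
      ENNReal.ofReal A * ∫⁻ u in Metric.closedBall x.2.2 L, g u := by
    intro x
    have hS : MeasurableSet {u : ℝ × ℝ × ℝ | u.2.2 ∈ Metric.closedBall x.2.2 L} :=
      Metric.isClosed_closedBall.measurableSet.preimage (by fun_prop)
    have hm := hfm.indicator hS
    calc _ ≤ ∫⁻ y : ℝ × ℝ × ℝ, ‖f (x - y) * K y‖ₑ := enorm_integral_le_lintegral_enorm _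
      _ ≤ ∫⁻ y : ℝ × ℝ × ℝ, ENNReal.ofReal A *
          {u : ℝ × ℝ × ℝ | u.2.2 ∈ Metric.closedBall x.2.2 L}.indicator (fun u => ‖f u‖ₑ) (x - y) := by
        gcongr with y
        by_cases hy : L < |y.2.2|
        · simp [hK y hy]
        · rw [Set.indicator_of_mem, enorm_mul, mul_comm]
          · gcongr
            rw [← ofReal_norm]
            exact ENNReal.ofReal_le_ofReal (hA y)
          · simpa [Real.dist_eq] using hy
      _ = ENNReal.ofReal A * ∫⁻ u : ℝ × ℝ × ℝ,
          {u : ℝ × ℝ × ℝ | u.2.2 ∈ Metric.closedBall x.2.2 L}.indicator (fun u => ‖f u‖ₑ) u := by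
        rw [lintegral_const_mul' _ _ (by finiteness), lintegral_sub_left_eq_self]
      _ = _ := by
        rw [← volume_preserving_prodAssoc.lintegral_comp hm]
        rw [show (volume : Measure ((ℝ × ℝ) × ℝ)) = (volume : Measure (ℝ × ℝ)).prod volume from rfl,
          lintegral_prod_symm' (fun a => {u : ℝ × ℝ × ℝ | u.2.2 ∈ Metric.closedBall x.2.2 L}.indicator (fun u => ‖f u‖ₑ) (MeasurableEquiv.prodAssoc a)) (hm.comp MeasurableEquiv.prodAssoc.measurable),
          ← lintegral_indicator Metric.isClosed_closedBall.measurableSet]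
        congr 2
        ext t
        by_cases ht : t ∈ Metric.closedBall x.2.2 L
        · rw [Set.indicator_of_mem ht, hg]
          simp only [eLpNorm_one_eq_lintegral_enorm]
          congr 1
          ext y
          rw [Set.indicator_of_mem (by exact ht)]
          rfl
        · rw [Set.indicator_of_notMem ht]
          rw [lintegral_eq_zero_iff' (by
            exact ((hm.comp MeasurableEquiv.prodAssoc.measurable).comp
              (measurable_id.prodMk measurable_const)).aemeasurable)]
          filter_upwards with y
          rw [Set.indicator_of_notMem (by exact ht)]
          rfl
  have hq0 : (2 / ENNReal.ofReal σ) ≠ 0 := by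
    simp [ENNReal.div_eq_zero_iff]
  calc _ ≤ outerNorm (2 / ENNReal.ofReal σ)
        (fun t => ENNReal.ofReal A * ∫⁻ u in Metric.closedBall t L, g u) := by
        apply outerNorm_mono
        intro t
        rw [eLpNorm_exponent_top]
        refine essSup_le_of_ae_le _ ?_
        filter_upwards with y
        exact pt (y.1, y.2, t)
    _ = ENNReal.ofReal A * outerNorm (2 / ENNReal.ofReal σ)
        (fun t => ∫⁻ u in Metric.closedBall t L, g u) :=
        outerNorm_const_mul _ hq0 _ (by finiteness)
    _ ≤ ENNReal.ofReal A * (ENNReal.ofReal ((2 * L) ^ σ) *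
          outerNorm (ENNReal.ofReal (2 / (2 - σ))) g) := by
        gcongr
        exact aux_young σ hσ0 hσ1 g hgm L (by linarith)
    _ ≤ _ := by
        rw [← mul_assoc, ← ENNReal.ofReal_mul hA0]
        unfold mixedNorm
        refine mul_le_mul_left (ENNReal.ofReal_le_ofReal ?_) _
        rw [Real.mul_rpow (by norm_num) (by linarith)]
        have h2 : (2 : ℝ) ^ σ ≤ 2 := by
          conv_rhs => rw [← Real.rpow_one 2]
          exact Real.rpow_le_rpow_of_exponent_le (by norm_num) hσ1.le
        have h3 : 0 ≤ L ^ σ := by positivity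
        calc A * (2 ^ σ * L ^ σ) ≤ A * (2 * L ^ σ) := by gcongr
          _ = _ := by ring

/-- Frequency-localized mixed-norm bound: if `‖μ‖_∞ ≤ B`, `‖ℱμ‖_∞ ≤ A` and
`supp ℱμ ⊆ ℝ² × [−λ₃,λ₃]` with `λ₃ ≥ 1`, then convolution with `ℱμ` is bounded
`L^{2/(2−σ)}_{x₃}(L¹) → L^{2/σ}_{x₃}(L^∞)` with norm `≲ A λ₃^σ` for every
`σ ∈ [0,1)`, and bounded on `L²` with norm `≲ B`. -/
theorem stmt_7 (σ : ℝ) (hσ0 : 0 ≤ σ) (hσ1 : σ < 1) :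
    ∃ C : ℝ, 0 < C ∧
      ∀ (m : ℝ × ℝ × ℝ → ℂ) (A B lam3 : ℝ), Measurable m → 1 ≤ lam3 →
        (∀ x, ‖m x‖ ≤ B) →
        (∀ ξ, ‖ft3 m ξ‖ ≤ A) →
        (∀ ξ : ℝ × ℝ × ℝ, lam3 < |ξ.2.2| → ft3 m ξ = 0) →
        (∀ f : SchwartzMap (ℝ × ℝ × ℝ) ℂ,
          mixedNorm ∞ (2 / ENNReal.ofReal σ)
              (fun x => ∫ y : ℝ × ℝ × ℝ, f (x - y) * ft3 m y) ≤
            ENNReal.ofReal (C * A * lam3 ^ σ) *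
              mixedNorm 1 (ENNReal.ofReal (2 / (2 - σ))) (fun x => f x)) ∧
        (∀ f : SchwartzMap (ℝ × ℝ × ℝ) ℂ,
          eLpNorm (fun x => ∫ y : ℝ × ℝ × ℝ, f (x - y) * ft3 m y) 2 volume ≤
            ENNReal.ofReal (C * B) * eLpNorm (fun x => f x) 2 volume) := by
  refine ⟨2, two_pos, fun m A B lam3 hm hl hB hA hs => ⟨fun f => ?_, fun f => ?_⟩⟩
  · exact aux_mixed σ hσ0 hσ1 (ft3 m) A lam3 hl hA hs f
  · refine (aux_L2 m B hm hB f).trans ?_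
    have hB0 : 0 ≤ B := (norm_nonneg _).trans (hB 0)
    gcongr
    linarith
end

section
/- Sharpness of the mixed-norm estimate: Let T f = f * ℱμ for a tempered Radon measure μ with continuous Fourier transform, let φ : [0,∞) → (0,∞) be increasing, unbounded and continuous, and suppose lim_{x₃→+∞} ℱμ(0,0,x₃)·(1+|x₃|)^{σ̃}/φ(|x₃|) exists and is nonzero for some σ̃ ∈ (0,1). Then T is not bounded from L^{2/(2−σ̃)}_{x₃}(L¹_{(x₁,x₂)}) to L^{2/σ̃}_{x₃}(L^∞_{(x₁,x₂)}). -/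
open MeasureTheory Filter
open scoped ENNReal

lemma outer_lower (σ : ℝ) (hσ0 : 0 < σ) (N a : ℝ) (hN : 0 < N) (ha : 0 ≤ a)
    (g : ℝ → ℝ≥0∞) (hg : ∀ x ∈ Set.Icc (3 * N) (4 * N), ENNReal.ofReal a ≤ g x) :
    ENNReal.ofReal (a * N ^ (σ / 2)) ≤ outerNorm (2 / ENNReal.ofReal σ) g := by
  have hq : (2 / ENNReal.ofReal σ : ℝ≥0∞) ≠ ∞ :=
    ENNReal.div_ne_top (by simp) (by simpa using hσ0)
  have hr : (2 / ENNReal.ofReal σ : ℝ≥0∞).toReal = 2 / σ := by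
    simp [ENNReal.toReal_div, hσ0.le]
  rw [outerNorm, if_neg hq, hr]
  have h1 : ENNReal.ofReal a ^ (2 / σ) * ENNReal.ofReal N ≤ ∫⁻ x, g x ^ (2 / σ) := by
    calc ENNReal.ofReal a ^ (2 / σ) * ENNReal.ofReal N
        = ∫⁻ x, (Set.Icc (3 * N) (4 * N)).indicator (fun _ => ENNReal.ofReal a ^ (2 / σ)) x := by
          rw [lintegral_indicator_const measurableSet_Icc, Real.volume_Icc]
          congr 2; ring
      _ ≤ _ := by
          apply lintegral_mono
          intro x
          by_cases hx : x ∈ Set.Icc (3 * N) (4 * N)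
          · simp only [Set.indicator_of_mem hx]
            exact ENNReal.rpow_le_rpow (hg x hx) (by positivity)
          · simp [Set.indicator_of_notMem hx]
  calc ENNReal.ofReal (a * N ^ (σ / 2))
      = (ENNReal.ofReal a ^ (2 / σ) * ENNReal.ofReal N) ^ (1 / (2 / σ)) := by
        rw [ENNReal.mul_rpow_of_nonneg _ _ (by positivity), ← ENNReal.rpow_mul,
          ENNReal.ofReal_mul ha, ENNReal.ofReal_rpow_of_pos hN]
        have h2 : 2 / σ * (1 / (2 / σ)) = 1 := by field_simp
        rw [h2, ENNReal.rpow_one, one_div_div]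
    _ ≤ _ := ENNReal.rpow_le_rpow h1 (by positivity)

lemma outer_upper (σ : ℝ) (hσ1 : σ < 1) (N : ℝ) (hN : 0 < N)
    (g : ℝ → ℝ≥0∞) (hg : ∀ x, g x ≤ (Metric.ball (0 : ℝ) N).indicator (fun _ => 1) x) :
    outerNorm (ENNReal.ofReal (2 / (2 - σ))) g ≤ ENNReal.ofReal ((2 * N) ^ (1 - σ / 2)) := by
  have h2 : 0 < 2 - σ := by linarith
  have hp : 0 < 2 / (2 - σ) := by positivity
  rw [outerNorm, if_neg ENNReal.ofReal_ne_top, ENNReal.toReal_ofReal hp.le]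
  have h1 : ∫⁻ x, g x ^ (2 / (2 - σ)) ≤ ENNReal.ofReal (2 * N) := by
    calc ∫⁻ x, g x ^ (2 / (2 - σ))
        ≤ ∫⁻ x, (Metric.ball (0 : ℝ) N).indicator (fun _ => 1) x := by
          apply lintegral_mono
          intro x
          refine (ENNReal.rpow_le_rpow (hg x) hp.le).trans ?_
          by_cases hx : x ∈ Metric.ball (0 : ℝ) N
          · simp [Set.indicator_of_mem hx]
          · simp only [Set.indicator_of_notMem hx]
            rw [ENNReal.zero_rpow_of_pos hp]
      _ = _ := by
          rw [lintegral_indicator_const Metric.isOpen_ball.measurableSet, Real.volume_ball, one_mul]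
  refine (ENNReal.rpow_le_rpow h1 (by positivity)).trans_eq ?_
  rw [ENNReal.ofReal_rpow_of_pos (by positivity)]
  congr 2
  rw [one_div_div]; ring

lemma eLpNorm_top_lower (F : ℝ × ℝ → ℂ) (ε a : ℝ) (hε : 0 < ε)
    (h : ∀ y ∈ Metric.ball (0 : ℝ × ℝ) ε, a ≤ ‖F y‖) :
    ENNReal.ofReal a ≤ eLpNorm F ∞ volume := by
  by_contra hcon
  push Not at hcon
  rw [eLpNorm_exponent_top] at hcon
  have h1 := enorm_ae_le_eLpNormEssSup F volume
  have h2 : volume (Metric.ball (0 : ℝ × ℝ) ε) = 0 := by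
    refine measure_mono_null ?_ (ae_iff.1 h1)
    intro y hy
    simp only [Set.mem_ofPred_eq, not_le]
    refine hcon.trans_le ?_
    rw [← ofReal_norm]
    exact ENNReal.ofReal_le_ofReal (h y hy)
  exact (Metric.measure_ball_pos volume (0 : ℝ × ℝ) hε).ne' h2

/-- The test function. -/
noncomputable def testF (b h : ℝ → ℝ) (x : ℝ × ℝ × ℝ) : ℝ := b x.1 * (b x.2.1 * h x.2.2)

lemma testF_compact (b h : ℝ → ℝ) (hb : HasCompactSupport b) (hh : HasCompactSupport h) :
    HasCompactSupport (testF b h) := by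
  refine HasCompactSupport.intro (K := tsupport b ×ˢ (tsupport b ×ˢ tsupport h))
    (hb.isCompact.prod (hb.isCompact.prod hh.isCompact)) ?_
  rintro ⟨x, y, z⟩ hx
  simp only [Set.mem_prod, not_and_or] at hx
  rcases hx with hx | hx | hx
  · simp [testF, image_eq_zero_of_notMem_tsupport hx]
  · simp [testF, image_eq_zero_of_notMem_tsupport hx]
  · simp [testF, image_eq_zero_of_notMem_tsupport hx]

lemma conv_lower (K : ℝ × ℝ × ℝ → ℂ) (hK : Continuous K) (c : ℂ) (hc : c ≠ 0)
    (F : ℝ × ℝ × ℝ → ℝ) (hF : Continuous F) (hFc : HasCompactSupport F) (hF0 : ∀ x, 0 ≤ F x)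
    (m : ℝ) (x : ℝ × ℝ × ℝ)
    (h : ∀ y, F (x - y) ≠ 0 → m * ‖c‖ ≤ (starRingEnd ℂ c * K y).re) :
    m * ∫ y, F y ≤ ‖∫ y, (F (x - y) : ℂ) * K y‖ := by
  have hcs : HasCompactSupport (fun y => F (x - y)) :=
    hFc.comp_homeomorph (Homeomorph.subLeft x)
  have hcs' : HasCompactSupport (fun y => (F (x - y) : ℂ)) :=
    hcs.comp_left (g := fun t : ℝ => (t : ℂ)) (by simp)
  have hi : Integrable (fun y => (F (x - y) : ℂ) * K y) :=
    Continuous.integrable_of_hasCompactSupport (by fun_prop) hcs'.mul_right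
  have hi2 : Integrable (fun y => F (x - y)) :=
    Continuous.integrable_of_hasCompactSupport (by fun_prop) hcs
  have hc' : 0 < ‖c‖ := norm_pos_iff.2 hc
  have key : m * ‖c‖ * ∫ y, F y ≤ (starRingEnd ℂ c * ∫ y, (F (x - y) : ℂ) * K y).re := by
    rw [← integral_const_mul (starRingEnd ℂ c)]
    have e1 : (∫ y, starRingEnd ℂ c * ((F (x - y) : ℂ) * K y)).re
        = ∫ y, (starRingEnd ℂ c * ((F (x - y) : ℂ) * K y)).re :=
      (integral_re (hi.const_mul _)).symm
    haveI : (volume : Measure (ℝ × ℝ × ℝ)).IsAddHaarMeasure :=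
      inferInstanceAs ((volume : Measure ℝ).prod (volume : Measure (ℝ × ℝ))).IsAddHaarMeasure
    haveI : (volume : Measure (ℝ × ℝ × ℝ)).IsNegInvariant :=
      Measure.IsAddHaarMeasure.isNegInvariant_of_regular _
    rw [e1, ← integral_sub_left_eq_self F volume x, ← integral_const_mul]
    apply integral_mono (hi2.const_mul _) (hi.const_mul _).re
    intro y
    have e2 : (starRingEnd ℂ c * ((F (x - y) : ℂ) * K y)).re
        = F (x - y) * (starRingEnd ℂ c * K y).re := by
      rw [mul_left_comm, Complex.re_ofReal_mul]
    show m * ‖c‖ * F (x - y) ≤ (starRingEnd ℂ c * ((F (x - y) : ℂ) * K y)).re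
    rw [e2, mul_comm]
    by_cases h0 : F (x - y) = 0
    · simp [h0]
    · exact mul_le_mul_of_nonneg_left (h y h0) (hF0 _)
  have k2 := key.trans (Complex.re_le_norm _)
  rw [norm_mul, RCLike.norm_conj] at k2
  nlinarith

lemma tube (K : ℝ × ℝ × ℝ → ℂ) (hK : Continuous K) (c : ℂ) (u v w : ℝ)
    (h : ∀ t ∈ Set.Icc u v, w < (starRingEnd ℂ c * K (0, 0, t)).re) :
    ∃ ε > 0, ∀ y : ℝ × ℝ × ℝ, |y.1| < 2 * ε → |y.2.1| < 2 * ε → y.2.2 ∈ Set.Icc u v →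
      w < (starRingEnd ℂ c * K y).re := by
  have hcpt : IsCompact ((fun t : ℝ => ((0, 0, t) : ℝ × ℝ × ℝ)) '' Set.Icc u v) :=
    isCompact_Icc.image (by fun_prop)
  have hopen : IsOpen {y | w < (starRingEnd ℂ c * K y).re} :=
    isOpen_lt continuous_const (Complex.continuous_re.comp (by fun_prop))
  obtain ⟨δ, hδ, hsub⟩ := hcpt.exists_thickening_subset_open hopen (by
    rintro _ ⟨t, ht, rfl⟩
    exact h t ht)
  refine ⟨δ / 2, by positivity, ?_⟩
  rintro ⟨y1, y2, y3⟩ h1 h2 h3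
  apply hsub
  rw [Metric.mem_thickening_iff]
  refine ⟨(0, 0, y3), ⟨y3, h3, rfl⟩, ?_⟩
  simp only [Prod.dist_eq, Real.dist_eq, sub_zero, sub_self, abs_zero]
  simp only at h1 h2
  rw [max_lt_iff, max_lt_iff]
  exact ⟨by linarith, by linarith, hδ⟩


/-- Sharpness of the mixed-norm estimate: if the continuous kernel `K = ℱμ` satisfies
`K(0,0,x₃)(1+|x₃|)^σ/φ(|x₃|) → c ≠ 0` as `x₃ → +∞` for an increasing, unbounded,
continuous `φ : [0,∞) → (0,∞)` and some `σ ∈ (0,1)`, then `f ↦ f * K` is not bounded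
from `L^{2/(2−σ)}_{x₃}(L¹)` to `L^{2/σ}_{x₃}(L^∞)`. -/
theorem stmt_8 (σ : ℝ) (hσ0 : 0 < σ) (hσ1 : σ < 1)
    (K : ℝ × ℝ × ℝ → ℂ) (hK : Continuous K)
    (φ : ℝ → ℝ) (hφc : ContinuousOn φ (Set.Ici 0))
    (hφpos : ∀ x : ℝ, 0 ≤ x → 0 < φ x) (hφmono : MonotoneOn φ (Set.Ici 0))
    (hφunb : Tendsto φ atTop atTop)
    (c : ℂ) (hc : c ≠ 0)
    (hlim : Tendsto
      (fun x₃ : ℝ => K (0, 0, x₃) * (((1 + |x₃|) ^ σ / φ |x₃| : ℝ) : ℂ))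
      atTop (nhds c)) :
    ¬ ∃ C : ℝ, ∀ f : SchwartzMap (ℝ × ℝ × ℝ) ℂ,
        mixedNorm ∞ (2 / ENNReal.ofReal σ)
            (fun x => ∫ y : ℝ × ℝ × ℝ, f (x - y) * K y) ≤
          ENNReal.ofReal C *
            mixedNorm 1 (ENNReal.ofReal (2 / (2 - σ))) (fun x => f x) := by
  rintro ⟨C, hC⟩
  have hc' : 0 < ‖c‖ := norm_pos_iff.2 hc
  set C' : ℝ := max C 1 with hC'
  have hC'pos : 0 < C' := lt_of_lt_of_le one_pos (le_max_right _ _)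
  -- constant to be beaten
  set D : ℝ := C' * 2 ^ (1 - σ / 2) * 6 ^ σ * 4 / ‖c‖ with hD
  have hre : Tendsto (fun x₃ : ℝ => (starRingEnd ℂ c *
      (K (0, 0, x₃) * (((1 + |x₃|) ^ σ / φ |x₃| : ℝ) : ℂ))).re) atTop (nhds (‖c‖ ^ 2)) := by
    have h1 := (Complex.continuous_re.tendsto _).comp (hlim.const_mul (starRingEnd ℂ c))
    have h2 : (starRingEnd ℂ c * c).re = ‖c‖ ^ 2 := by
      rw [mul_comm, Complex.mul_conj, Complex.ofReal_re, Complex.normSq_eq_norm_sq]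
    rw [h2] at h1
    exact h1
  have hev := hre.eventually (lt_mem_nhds (show ‖c‖ ^ 2 / 2 < ‖c‖ ^ 2 by nlinarith [pow_pos hc' 2]))
  obtain ⟨R, hR⟩ := eventually_atTop.1 (hev.and (hφunb.eventually_gt_atTop D))
  set N : ℝ := max R 1 with hNdef
  have hN1 : 1 ≤ N := le_max_right _ _
  have hN : 0 < N := by linarith
  have hRN : R ≤ 2 * N := by linarith [le_max_left R 1]
  have hφN : D < φ (2 * N) := (hR _ hRN).2
  have hφN0 : 0 < φ (2 * N) := hφpos _ (by linarith)
  set m : ℝ := ‖c‖ / 4 * (φ (2 * N) / (6 * N) ^ σ) with hm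
  have h6 : 0 < (6 * N) ^ σ := Real.rpow_pos_of_pos (by positivity) _
  have hm0 : 0 < m := by positivity
  have hKlow : ∀ t ∈ Set.Icc (2 * N) (5 * N), m * ‖c‖ < (starRingEnd ℂ c * K (0, 0, t)).re := by
    intro t ht
    have ht0 : 0 < t := by linarith [ht.1]
    have h1 := (hR t (by linarith [ht.1])).1
    rw [← mul_assoc, Complex.re_mul_ofReal, abs_of_pos ht0] at h1
    have hφt : φ (2 * N) ≤ φ t :=
      hφmono (by simp; positivity) (by simp; positivity) ht.1
    have hpow : (1 + t) ^ σ ≤ (6 * N) ^ σ :=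
      Real.rpow_le_rpow (by positivity) (by linarith [ht.2]) hσ0.le
    have hpow0 : 0 < (1 + t) ^ σ := by positivity
    have hφt0 : 0 < φ t := by linarith
    have h2 : ‖c‖ ^ 2 / 2 * (φ t / (1 + t) ^ σ) < (starRingEnd ℂ c * K (0, 0, t)).re := by
      rw [← mul_div_assoc, lt_div_iff₀ hφt0] at h1
      rw [← mul_div_assoc, div_lt_iff₀ hpow0]
      exact h1
    have h3 : φ (2 * N) / (6 * N) ^ σ ≤ φ t / (1 + t) ^ σ := by gcongr
    have h4 : 0 < φ (2 * N) / (6 * N) ^ σ := by positivity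
    refine lt_of_le_of_lt ?_ h2
    rw [hm]
    have : 0 < ‖c‖ ^ 2 := by positivity
    nlinarith [mul_le_mul_of_nonneg_left h3 this.le, mul_pos this h4]
  obtain ⟨ε, hε, htube⟩ := tube K hK c _ _ _ hKlow
  let B : ContDiffBump (0 : ℝ) := ⟨ε / 2, ε, by positivity, by linarith⟩
  let H : ContDiffBump (0 : ℝ) := ⟨N / 2, N, by positivity, by linarith⟩
  let b : ℝ → ℝ := B.normed volume
  let h : ℝ → ℝ := H
  have hb0 : ∀ x, 0 ≤ b x := B.nonneg_normed
  have hh0 : ∀ x, 0 ≤ h x := fun x => H.nonneg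
  have hh1 : ∀ x, h x ≤ 1 := fun x => H.le_one
  have hbs : ∀ x, b x ≠ 0 → |x| < ε := by
    intro x hx
    have h1 : x ∈ Function.support (B.normed volume) := hx
    rw [B.support_normed_eq] at h1
    simpa [B] using h1
  have hhs : ∀ x, h x ≠ 0 → |x| < N := by
    intro x hx
    have h1 : x ∈ Function.support H := hx
    rw [H.support_eq] at h1
    simpa [H] using h1
  have hbc : ContDiff ℝ (⊤ : ℕ∞) b := B.contDiff_normed
  have hhc : ContDiff ℝ (⊤ : ℕ∞) h := H.contDiff
  have hbI : ∫ x, b x = 1 := B.integral_normed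
  have hbi : Integrable b := B.integrable_normed
  have hhI : N ≤ ∫ x, h x := by
    have h1 := H.measure_closedBall_le_integral volume
    have h2 : volume.real (Metric.closedBall (0 : ℝ) H.rIn) = N := by
      rw [Measure.real, Real.volume_closedBall, ENNReal.toReal_ofReal (by positivity)]
      simp [H]; ring
    rw [h2] at h1
    exact h1
  have hFs : ContDiff ℝ (⊤ : ℕ∞) (testF b h) := by
    unfold testF
    fun_prop
  have hFcs : HasCompactSupport (testF b h) :=
    testF_compact b h B.hasCompactSupport_normed H.hasCompactSupport
  have hF0 : ∀ x, 0 ≤ testF b h x := fun x =>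
    mul_nonneg (hb0 _) (mul_nonneg (hb0 _) (hh0 _))
  have hFI : N ≤ ∫ x, testF b h x := by
    have e : ∫ x, testF b h x = ∫ x, h x := by
      unfold testF
      rw [Measure.volume_eq_prod, integral_prod_mul b (fun z : ℝ × ℝ => b z.1 * h z.2),
        Measure.volume_eq_prod, integral_prod_mul b h, hbI, one_mul, one_mul]
    rw [e]; exact hhI
  have hGcs : HasCompactSupport (fun x => (testF b h x : ℂ)) :=
    hFcs.comp_left (g := fun t : ℝ => (t : ℂ)) (by simp)
  have hGs : ContDiff ℝ (⊤ : ℕ∞) (fun x => (testF b h x : ℂ)) :=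
    Complex.ofRealCLM.contDiff.comp hFs
  have hmain := hC (hGcs.toSchwartzMap hGs)
  have hlow : ENNReal.ofReal (m * N * N ^ (σ / 2)) ≤ mixedNorm ∞ (2 / ENNReal.ofReal σ)
      (fun x => ∫ y : ℝ × ℝ × ℝ, (hGcs.toSchwartzMap hGs) (x - y) * K y) := by
    apply outer_lower σ hσ0 N _ hN (by positivity)
    intro x₃ hx₃
    apply eLpNorm_top_lower _ ε _ hε
    rintro ⟨x₁, x₂⟩ hx
    have hx12 : |x₁| < ε ∧ |x₂| < ε := by
      simpa [Prod.dist_eq, Prod.norm_def] using hx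
    refine le_trans ?_ (conv_lower K hK c hc (testF b h) hFs.continuous hFcs hF0 m
      (x₁, x₂, x₃) ?_)
    · exact mul_le_mul_of_nonneg_left hFI hm0.le
    · rintro ⟨y₁, y₂, y₃⟩ hy
      simp only [testF, Prod.mk_sub_mk, mul_ne_zero_iff] at hy
      obtain ⟨hy1, hy2, hy3⟩ := hy
      have a1 := abs_lt.1 (hbs _ hy1)
      have a2 := abs_lt.1 (hbs _ hy2)
      have a3 := abs_lt.1 (hhs _ hy3)
      have b1 := abs_lt.1 hx12.1
      have b2 := abs_lt.1 hx12.2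
      refine (htube (y₁, y₂, y₃) ?_ ?_ ?_).le
      · exact abs_lt.2 ⟨by linarith, by linarith⟩
      · exact abs_lt.2 ⟨by linarith, by linarith⟩
      · exact ⟨by linarith [hx₃.1], by linarith [hx₃.2]⟩
  have hup : mixedNorm 1 (ENNReal.ofReal (2 / (2 - σ))) (fun x => (hGcs.toSchwartzMap hGs) x) ≤
      ENNReal.ofReal ((2 * N) ^ (1 - σ / 2)) := by
    apply outer_upper σ hσ1 N hN
    intro x₃
    have e : eLpNorm (fun y : ℝ × ℝ => (hGcs.toSchwartzMap hGs) (y.1, y.2, x₃)) 1 volume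
        = ENNReal.ofReal (h x₃) := by
      rw [eLpNorm_one_eq_lintegral_enorm]
      have e1 : ∀ y : ℝ × ℝ, ‖(hGcs.toSchwartzMap hGs) (y.1, y.2, x₃)‖ₑ
          = ENNReal.ofReal (b y.1 * (b y.2 * h x₃)) := by
        intro y
        rw [← ofReal_norm]
        congr 1
        show ‖((testF b h (y.1, y.2, x₃) : ℝ) : ℂ)‖ = _
        rw [Complex.norm_real, Real.norm_of_nonneg (hF0 _)]
        rfl
      simp_rw [e1]
      rw [← ofReal_integral_eq_lintegral_ofReal]
      · rw [Measure.volume_eq_prod, integral_prod_mul b (fun z : ℝ => b z * h x₃), hbI,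
          integral_mul_const, hbI, one_mul, one_mul]
      · rw [Measure.volume_eq_prod]
        exact hbi.mul_prod (hbi.mul_const _)
      · exact Eventually.of_forall fun y => mul_nonneg (hb0 _) (mul_nonneg (hb0 _) (hh0 _))
    rw [e]
    by_cases hx : x₃ ∈ Metric.ball (0 : ℝ) N
    · rw [Set.indicator_of_mem hx]
      exact ENNReal.ofReal_le_one.2 (hh1 _)
    · rw [Set.indicator_of_notMem hx]
      have : h x₃ = 0 := by
        by_contra h0
        exact hx (by simpa using hhs _ h0)
      simp [this]
  have hfin : ENNReal.ofReal (m * N * N ^ (σ / 2)) ≤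
      ENNReal.ofReal (C' * (2 * N) ^ (1 - σ / 2)) := by
    rw [ENNReal.ofReal_mul hC'pos.le]
    exact hlow.trans (hmain.trans (mul_le_mul' (ENNReal.ofReal_le_ofReal (le_max_left _ _)) hup))
  rw [ENNReal.ofReal_le_ofReal_iff (by positivity)] at hfin
  have hpw : N * N ^ (σ / 2) = N ^ (1 - σ / 2) * N ^ σ := by
    rw [← Real.rpow_add hN]
    nth_rewrite 1 [← Real.rpow_one N]
    rw [← Real.rpow_add hN]
    congr 1; ring
  rw [mul_assoc, hpw, hm, Real.mul_rpow (by norm_num) hN.le, Real.mul_rpow (by norm_num) hN.le]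
    at hfin
  rw [hD, div_lt_iff₀ hc'] at hφN
  have p1 : 0 < N ^ (1 - σ / 2) := by positivity
  have p2 : 0 < N ^ σ := by positivity
  have p3 : (0 : ℝ) < 6 ^ σ := by positivity
  have e3 : ‖c‖ / 4 * (φ (2 * N) / (6 ^ σ * N ^ σ)) * (N ^ (1 - σ / 2) * N ^ σ)
      = (φ (2 * N) * ‖c‖ / (4 * 6 ^ σ)) * N ^ (1 - σ / 2) := by
    field_simp
  rw [e3, ← mul_assoc, mul_le_mul_iff_left₀ p1, div_le_iff₀ (by positivity)] at hfin
  linarith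
end
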